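/- (Weighted Naruse formula, type D.) Let λ and μ be strict partitions with μ ⊆ λ, and let z_0, z_1, z_2, … be positive real numbers. Then Σ_{T ∈ SYT(λ/μ)} T_z^D = Σ_{D ∈ E^D(λ/μ)} ∏_{u ∈ [λ]^D ∖ D} 1/h^D(u; z). -/

import Mathlib

attribute [local instance] Classical.propDecidable

/-- `l : ℕ → ℕ` encodes a strict partition: the parts are `l 1 > l 2 > ⋯ > l ℓ > 0`
(indexed from `1`), with `l i = 0` for `i > ℓ` (and `l 0 = 0` by convention). -/
def IsStrictPartition (l : ℕ → ℕ) : Prop :=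
  l 0 = 0 ∧ ∀ i, 1 ≤ i → (l i = 0 → l (i + 1) = 0) ∧ (l i ≠ 0 → l (i + 1) < l i)

/-- The shifted diagram of type B: cells `(i,j)` with `1 ≤ i ≤ ℓ(λ)` and
`i ≤ j ≤ λ_i + i - 1`.  (For a strict partition all such cells satisfy
`i ≤ l 1` and `j ≤ 2 * l 1 + 2`, so the ambient box loses nothing.) -/
noncomputable def cellsB (l : ℕ → ℕ) : Finset (ℕ × ℕ) :=
  (Finset.Icc 1 (l 1) ×ˢ Finset.Icc 1 (2 * l 1 + 2)).filter
    (fun p => p.1 ≤ p.2 ∧ p.2 < l p.1 + p.1)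

/-- The shifted diagram of type D: cells `(i,j)` with `1 ≤ i ≤ ℓ(λ)` and
`i + 1 ≤ j ≤ λ_i + i`. -/
noncomputable def cellsD (l : ℕ → ℕ) : Finset (ℕ × ℕ) :=
  (Finset.Icc 1 (l 1) ×ˢ Finset.Icc 1 (2 * l 1 + 2)).filter
    (fun p => p.1 < p.2 ∧ p.2 ≤ l p.1 + p.1)

/-- `λ'_k`: the number of cells of `[λ]^B` in column `k`. -/
noncomputable def colB (l : ℕ → ℕ) (k : ℕ) : ℕ :=
  ((cellsB l).filter (fun p => p.2 = k)).card

/-- The size `|λ|` of a strict partition. -/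
noncomputable def spSize (l : ℕ → ℕ) : ℕ := ∑ i ∈ Finset.Icc 1 (l 1), l i

/-- The length `ℓ(λ)` (number of nonzero parts) of a strict partition. -/
noncomputable def spLength (l : ℕ → ℕ) : ℕ :=
  ((Finset.Icc 1 (l 1)).filter (fun i => l i ≠ 0)).card

/-- `μ ⋖ ν` for strict partitions (containment via type B diagrams and `|ν| = |μ| + 1`). -/
def CoversB (m n : ℕ → ℕ) : Prop :=
  cellsB m ⊆ cellsB n ∧ spSize n = spSize m + 1

/-- `μ ⋖ ν` for strict partitions (containment via type D diagrams and `|ν| = |μ| + 1`). -/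
def CoversD (m n : ℕ → ℕ) : Prop :=
  cellsD m ⊆ cellsD n ∧ spSize n = spSize m + 1

/-- An excited move of type B with respect to `λ`. -/
def ExcitedMoveB (l : ℕ → ℕ) (D D' : Finset (ℕ × ℕ)) : Prop :=
  ∃ i j : ℕ, (i, j) ∈ D ∧
    (i + 1, j) ∈ cellsB l ∧ (i + 1, j) ∉ D ∧
    (i, j + 1) ∈ cellsB l ∧ (i, j + 1) ∉ D ∧
    (i + 1, j + 1) ∈ cellsB l ∧ (i + 1, j + 1) ∉ D ∧
    D' = insert (i + 1, j + 1) (D.erase (i, j))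

/-- The excited diagrams of type B of shape `λ/μ`: subsets of `[λ]^B` obtainable from
`[μ]^B` by finite sequences of excited moves of type B. -/
noncomputable def EB (l m : ℕ → ℕ) : Finset (Finset (ℕ × ℕ)) :=
  (cellsB l).powerset.filter
    (fun D => Relation.ReflTransGen (ExcitedMoveB l) (cellsB m) D)

/-- An excited move of type D with respect to `λ`. -/
def ExcitedMoveD (l : ℕ → ℕ) (D D' : Finset (ℕ × ℕ)) : Prop :=
  (∃ i j : ℕ, i + 1 < j ∧ (i, j) ∈ D ∧
    (i + 1, j) ∈ cellsD l ∧ (i + 1, j) ∉ D ∧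
    (i, j + 1) ∈ cellsD l ∧ (i, j + 1) ∉ D ∧
    (i + 1, j + 1) ∈ cellsD l ∧ (i + 1, j + 1) ∉ D ∧
    D' = insert (i + 1, j + 1) (D.erase (i, j))) ∨
  (∃ i : ℕ, (i, i + 1) ∈ D ∧
    (i, i + 2) ∈ cellsD l ∧ (i, i + 2) ∉ D ∧
    (i, i + 3) ∈ cellsD l ∧ (i, i + 3) ∉ D ∧
    (i + 1, i + 2) ∈ cellsD l ∧ (i + 1, i + 2) ∉ D ∧
    (i + 1, i + 3) ∈ cellsD l ∧ (i + 1, i + 3) ∉ D ∧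
    (i + 2, i + 3) ∈ cellsD l ∧ (i + 2, i + 3) ∉ D ∧
    D' = insert (i + 2, i + 3) (D.erase (i, i + 1)))

/-- The excited diagrams of type D of shape `λ/μ`. -/
noncomputable def ED (l m : ℕ → ℕ) : Finset (Finset (ℕ × ℕ)) :=
  (cellsD l).powerset.filter
    (fun D => Relation.ReflTransGen (ExcitedMoveD l) (cellsD m) D)

/-- The set `W^B(μ, λ)`: all `1 ≤ k ≤ ℓ(λ)` with `λ_k ≠ μ_i` for all `i ≥ 1`, together
with all `k ≥ ℓ(λ) + 1` with `λ'_k - k ≠ μ'_i - i` for all `i ≥ 1`.  (All its elements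
are at most `λ_1 + μ_1 + 2`, so the ambient interval loses nothing.) -/
noncomputable def WB (m l : ℕ → ℕ) : Finset ℕ :=
  (Finset.Icc 1 (l 1 + m 1 + 2)).filter (fun k =>
    (k ≤ spLength l ∧ ∀ i, 1 ≤ i → l k ≠ m i) ∨
    (spLength l + 1 ≤ k ∧ ∀ i, 1 ≤ i → (colB l k : ℤ) - k ≠ (colB m i : ℤ) - i))

/-- The set `W^D(μ, λ)`. -/
noncomputable def WD (m l : ℕ → ℕ) : Finset ℕ :=
  (Finset.Icc 1 (l 1 + m 1 + 3)).filter (fun k =>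
    (k ≤ spLength l ∧ ∀ i, 1 ≤ i → l k ≠ m i) ∨
    (k = spLength l + 1 ∧ Odd ((spLength l : ℤ) - (spLength m : ℤ))) ∨
    (spLength l + 2 ≤ k ∧ ∀ i, 1 ≤ i → (colB l k : ℤ) - k ≠ (colB m i : ℤ) - i))

/-- The type B hook length of a cell of `[λ]^B`. -/
noncomputable def hB (l : ℕ → ℕ) (p : ℕ × ℕ) : ℤ :=
  if p.1 = p.2 then (l p.1 : ℤ)
  else if p.2 ≤ spLength l then (l p.1 : ℤ) + (l p.2 : ℤ)
  else ((l p.1 : ℤ) + (p.1 : ℤ) - (p.2 : ℤ)) + ((colB l p.2 : ℤ) - (p.1 : ℤ))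

/-- The type D hook length of a cell of `[λ]^D`. -/
noncomputable def hD (l : ℕ → ℕ) (p : ℕ × ℕ) : ℤ :=
  if p.2 ≤ spLength l then (l p.1 : ℤ) + (l p.2 : ℤ)
  else ((l p.1 : ℤ) + (p.1 : ℤ) - (p.2 : ℤ) + 1) + ((colB l (p.2 - 1) : ℤ) - (p.1 : ℤ))

/-- A standard Young tableau on a finite set of cells, encoded as `T : ℕ × ℕ → ℕ`
which is `0` off the cells and restricts to a bijection onto `{1, …, n}`,
increasing along rows and columns. -/
def IsSYT (cells : Finset (ℕ × ℕ)) (T : ℕ × ℕ → ℕ) : Prop :=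
  Set.BijOn T ↑cells ↑(Finset.Icc 1 cells.card) ∧
  (∀ p, p ∉ cells → T p = 0) ∧
  (∀ i j : ℕ, (i, j) ∈ cells → (i, j + 1) ∈ cells → T (i, j) < T (i, j + 1)) ∧
  (∀ i j : ℕ, (i, j) ∈ cells → (i + 1, j) ∈ cells → T (i, j) < T (i + 1, j))

/-- The skew diagram `[λ]^B ∖ [μ]^B`. -/
noncomputable def skewB (l m : ℕ → ℕ) : Finset (ℕ × ℕ) := cellsB l \ cellsB m

/-- The skew diagram `[λ]^D ∖ [μ]^D`. -/
noncomputable def skewD (l m : ℕ → ℕ) : Finset (ℕ × ℕ) := cellsD l \ cellsD m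

/-- `f^{λ/μ}`: the number of standard Young tableaux of shifted skew shape `λ/μ`
(type B diagrams). -/
noncomputable def fB (l m : ℕ → ℕ) : ℕ :=
  Nat.card {T : ℕ × ℕ → ℕ // IsSYT (skewB l m) T}

/-- `f^{λ/μ}` via the type D diagrams. -/
noncomputable def fD (l m : ℕ → ℕ) : ℕ :=
  Nat.card {T : ℕ × ℕ → ℕ // IsSYT (skewD l m) T}

/-- `x_k^B = λ_k` for `k ≤ ℓ(λ)` and `x_k^B = λ'_k - k` for `k > ℓ(λ)`. -/
noncomputable def xB (l : ℕ → ℕ) (k : ℕ) : ℤ :=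
  if k ≤ spLength l then (l k : ℤ) else (colB l k : ℤ) - (k : ℤ)

/-- `x_k^D = λ_k` for `k ≤ ℓ(λ)` and `x_k^D = λ'_{k-1} - k + 1` for `k > ℓ(λ)`. -/
noncomputable def xD (l : ℕ → ℕ) (k : ℕ) : ℤ :=
  if k ≤ spLength l then (l k : ℤ) else (colB l (k - 1) : ℤ) - (k : ℤ) + 1

/-- The weighted type B hook length `h^B(u; z)`: the sum of `z_{c(v)}` over the cells `v`
of the type B hook of `u` (the diagonal cell `(j,j)` counted twice when `i < j ≤ ℓ(λ)`). -/
noncomputable def hBz (l : ℕ → ℕ) (z : ℕ → ℝ) (u : ℕ × ℕ) : ℝ :=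
  (∑ p ∈ (cellsB l).filter (fun p => p.1 = u.1 ∧ u.2 ≤ p.2), z (p.2 - p.1)) +
  (∑ p ∈ (cellsB l).filter (fun p => p.2 = u.2 ∧ u.1 < p.1), z (p.2 - p.1)) +
  (if u.1 < u.2 ∧ u.2 ≤ spLength l then
      ∑ p ∈ (cellsB l).filter (fun p => p.1 = u.2), z (p.2 - p.1)
    else 0)

/-- The weighted type D hook length `h^D(u; z)`. -/
noncomputable def hDz (l : ℕ → ℕ) (z : ℕ → ℝ) (u : ℕ × ℕ) : ℝ :=
  (∑ p ∈ (cellsD l).filter (fun p => p.1 = u.1 ∧ u.2 ≤ p.2), z (p.2 - p.1)) +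
  (∑ p ∈ (cellsD l).filter (fun p => p.2 = u.2 ∧ u.1 < p.1), z (p.2 - p.1)) +
  (∑ p ∈ (cellsD l).filter (fun p => p.1 = u.2), z (p.2 - p.1))

/-- The weight `T_z` of a standard Young tableau `T` on `cells` (with `n = |cells|`):
`∏_{k=1}^n (z_{c(T⁻¹(n))} + ⋯ + z_{c(T⁻¹(k))})⁻¹`. -/
noncomputable def Tz (cells : Finset (ℕ × ℕ)) (z : ℕ → ℝ) (T : ℕ × ℕ → ℕ) : ℝ :=
  ∏ k ∈ Finset.Icc 1 cells.card,
    (∑ p ∈ cells.filter (fun p => k ≤ T p), z (p.2 - p.1))⁻¹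

/-- `x_k^B(z) = z_0 + ⋯ + z_{λ_k - 1}` for `k ≤ ℓ(λ)`, and
`x_k^B(z) = -(z_0 + ⋯ + z_{k - λ'_k - 1})` for `k > ℓ(λ)`. -/
noncomputable def xBz (l : ℕ → ℕ) (z : ℕ → ℝ) (k : ℕ) : ℝ :=
  if k ≤ spLength l then ∑ t ∈ Finset.range (l k), z t
  else -∑ t ∈ Finset.range (k - colB l k), z t



/-- order ideals of the shifted quarter plane -/
def Shp (S : Finset (ℕ × ℕ)) : Prop :=
  (∀ i j, (i, j) ∈ S → 1 ≤ i ∧ i < j) ∧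
  (∀ i j, (i + 1, j) ∈ S → 1 ≤ i → (i, j) ∈ S) ∧
  (∀ i j, (i, j + 1) ∈ S → i < j → (i, j) ∈ S)

lemma Shp.up {S : Finset (ℕ × ℕ)} (h : Shp S) (k : ℕ) : ∀ a j, (a + k, j) ∈ S → 1 ≤ a →
    (a, j) ∈ S := by
  induction k with
  | zero => intro a j h1 _; exact h1
  | succ k ih => intro a j h1 h2; exact ih a j (h.2.1 _ _ h1 (by omega)) h2

lemma Shp.left {S : Finset (ℕ × ℕ)} (h : Shp S) (k : ℕ) : ∀ a b, (a, b + k) ∈ S → a < b →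
    (a, b) ∈ S := by
  induction k with
  | zero => intro a j h1 _; exact h1
  | succ k ih => intro a j h1 h2; exact ih a j (h.2.2 _ _ h1 (by omega)) h2

lemma Shp.nw {S : Finset (ℕ × ℕ)} (h : Shp S) {p q : ℕ × ℕ} (hp : p ∈ S) (ha : 1 ≤ q.1)
    (hab : q.1 < q.2) (h1 : q.1 ≤ p.1) (h2 : q.2 ≤ p.2) : q ∈ S := by
  obtain ⟨i, j⟩ := p
  obtain ⟨a, b⟩ := q
  simp only at *
  obtain ⟨k, rfl⟩ := Nat.exists_eq_add_of_le h1
  obtain ⟨t, rfl⟩ := Nat.exists_eq_add_of_le h2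
  exact h.left t _ _ (h.up k _ _ hp ha) hab

lemma Shp.val {S : Finset (ℕ × ℕ)} (h : Shp S) {p : ℕ × ℕ} (hp : p ∈ S) : 1 ≤ p.1 ∧ p.1 < p.2 :=
  h.1 p.1 p.2 hp

def Rem (S : Finset (ℕ × ℕ)) (b : ℕ × ℕ) : Prop :=
  b ∈ S ∧ (b.1 + 1, b.2) ∉ S ∧ (b.1, b.2 + 1) ∉ S

def Addb (S : Finset (ℕ × ℕ)) (b : ℕ × ℕ) : Prop := b ∉ S ∧ Shp (insert b S)

lemma Shp.erase {S : Finset (ℕ × ℕ)} (h : Shp S) {b : ℕ × ℕ} (hb : Rem S b) :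
    Shp (S.erase b) := by
  obtain ⟨h1, h2, h3⟩ := h
  obtain ⟨b1, b2, b3⟩ := hb
  refine ⟨fun i j hij => h1 i j (Finset.mem_of_mem_erase hij), fun i j hij hi => ?_,
    fun i j hij hi => ?_⟩
  · rw [Finset.mem_erase] at hij ⊢
    refine ⟨?_, h2 i j hij.2 hi⟩
    rintro rfl; exact b2 hij.2
  · rw [Finset.mem_erase] at hij ⊢
    refine ⟨?_, h3 i j hij.2 hi⟩
    rintro rfl; exact b3 hij.2

/-- the maximal cells have nothing to the south-east -/
lemma Rem.max {S : Finset (ℕ × ℕ)} {b : ℕ × ℕ} (hb : Rem S b) (h : Shp S) {p : ℕ × ℕ} (hp : p ∈ S)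
    (h1 : b.1 ≤ p.1) (h2 : b.2 ≤ p.2) : p = b := by
  have vb := h.val hb.1
  have vp := h.val hp
  by_contra hne
  rcases Nat.lt_or_ge b.2 p.2 with h3 | h3
  · exact hb.2.2 (h.nw hp vb.1 (by simp; omega) h1 h3)
  · rcases Nat.lt_or_ge b.1 p.1 with h4 | h4
    · exact hb.2.1 (h.nw hp (by simp) (by simp; omega) h4 h2)
    · exact hne (Prod.ext (by omega) (by omega))

def col (p : ℕ × ℕ) : ℕ := if p.2 = p.1 + 1 then p.1 % 2 else p.2 - p.1

lemma col_eq {p q : ℕ × ℕ} (hp : p.1 < p.2) (hq : q.1 < q.2) : col p = col q ↔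
    p.2 + q.1 = q.2 + p.1 ∧ (p.2 = p.1 + 1 → p.1 % 2 = q.1 % 2) := by
  unfold col
  split_ifs <;> omega

/-- comparability of removable / members of same color -/
lemma Rem.le_of_col {S : Finset (ℕ × ℕ)} {b : ℕ × ℕ} (hb : Rem S b) (h : Shp S) {p : ℕ × ℕ}
    (hp : p ∈ S) (hc : col p = col b) : p.1 ≤ b.1 ∧ p.2 ≤ b.2 := by
  have vb := h.val hb.1
  have vp := h.val hp
  have := (col_eq vp.2 vb.2).1 hc
  by_contra hne
  have := hb.max h hp (by omega) (by omega)
  subst this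
  omega

lemma Rem.unique {S : Finset (ℕ × ℕ)} {b b' : ℕ × ℕ} (hb : Rem S b) (hb' : Rem S b') (h : Shp S)
    (hc : col b = col b') : b = b' := by
  have h1 := hb.le_of_col h hb'.1 hc.symm
  have h2 := hb'.le_of_col h hb.1 hc
  exact Prod.ext (by omega) (by omega)

def StepC (v v' : ℕ × ℕ) : Prop :=
  (v.1 + 1 < v.2 ∧ v' = (v.1 + 1, v.2 + 1)) ∨ (v.2 = v.1 + 1 ∧ v' = (v.1 + 2, v.2 + 2))

def Rect (v v' x : ℕ × ℕ) : Prop :=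
  v.1 ≤ x.1 ∧ x.1 ≤ v'.1 ∧ v.2 ≤ x.2 ∧ x.2 ≤ v'.2 ∧ x.1 < x.2 ∧ x ≠ v

def EM (L D D' : Finset (ℕ × ℕ)) : Prop :=
  ∃ v v', StepC v v' ∧ v ∈ D ∧ (∀ x, Rect v v' x → x ∈ L ∧ x ∉ D) ∧ D' = insert v' (D.erase v)

lemma excitedMoveD_eq (l : ℕ → ℕ) : ExcitedMoveD l = EM (cellsD l) := by
  funext D D'
  apply propext
  constructor
  · rintro (⟨i, j, h0, h1, h2, h3, h4, h5, h6, h7, h8⟩ | ⟨i, h1, h2, h3, h4, h5, h6, h7, h8, h9, h10, h11, h12⟩)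
    · refine ⟨(i, j), (i + 1, j + 1), Or.inl ⟨h0, rfl⟩, h1, ?_, h8⟩
      rintro ⟨a, b⟩ ⟨r1, r2, r3, r4, r5, r6⟩
      simp only [ne_eq, Prod.mk.injEq] at *
      obtain rfl | rfl : a = i ∨ a = i + 1 := by omega
      · obtain rfl : b = j + 1 := by omega
        exact ⟨h4, h5⟩
      · obtain rfl | rfl : b = j ∨ b = j + 1 := by omega
        · exact ⟨h2, h3⟩
        · exact ⟨h6, h7⟩
    · refine ⟨(i, i + 1), (i + 2, i + 3), Or.inr ⟨rfl, rfl⟩, h1, ?_, h12⟩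
      rintro ⟨a, b⟩ ⟨r1, r2, r3, r4, r5, r6⟩
      simp only [ne_eq, Prod.mk.injEq] at *
      obtain rfl | rfl | rfl : a = i ∨ a = i + 1 ∨ a = i + 2 := by omega
      · obtain rfl | rfl : b = a + 2 ∨ b = a + 3 := by omega
        · exact ⟨h2, h3⟩
        · exact ⟨h4, h5⟩
      · obtain rfl | rfl : b = i + 2 ∨ b = i + 3 := by omega
        · exact ⟨h6, h7⟩
        · exact ⟨h8, h9⟩
      · obtain rfl : b = i + 3 := by omega
        exact ⟨h10, h11⟩
  · rintro ⟨⟨i, j⟩, v', (⟨h0, rfl⟩ | ⟨h0, rfl⟩), h1, h2, h3⟩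
    · left
      simp only at *
      have a1 := h2 (i + 1, j) (by simp [Rect]; omega)
      have a2 := h2 (i, j + 1) (by simp [Rect]; omega)
      have a3 := h2 (i + 1, j + 1) (by simp [Rect]; omega)
      exact ⟨i, j, h0, h1, a1.1, a1.2, a2.1, a2.2, a3.1, a3.2, h3⟩
    · right
      simp only at *
      subst h0
      have a1 := h2 (i, i + 2) (by simp [Rect])
      have a2 := h2 (i, i + 3) (by simp [Rect])
      have a3 := h2 (i + 1, i + 2) (by simp [Rect])
      have a4 := h2 (i + 1, i + 3) (by simp [Rect])
      have a5 := h2 (i + 2, i + 3) (by simp [Rect])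
      exact ⟨i, h1, a1.1, a1.2, a2.1, a2.2, a3.1, a3.2, a4.1, a4.2, a5.1, a5.2, h3⟩

lemma StepC.rect {v v' : ℕ × ℕ} (h : StepC v v') : Rect v v' v' := by
  obtain ⟨i, j⟩ := v
  rcases h with ⟨h0, rfl⟩ | ⟨h0, rfl⟩ <;> simp [Rect] at * <;> omega

lemma StepC.lt {v v' : ℕ × ℕ} (h : StepC v v') :
    v.1 < v.2 ∧ v.1 < v'.1 ∧ v.2 < v'.2 ∧ v'.2 + v.1 = v.2 + v'.1 ∧ v'.1 < v'.2 ∧ 1 ≤ v'.1 := by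
  obtain ⟨i, j⟩ := v
  rcases h with ⟨h0, rfl⟩ | ⟨h0, rfl⟩ <;> simp at * <;> omega

/-- no cell of the rectangle, other than the target, can be maximal -/
lemma rect_ne {L : Finset (ℕ × ℕ)} (hL : Shp L) {c v v' : ℕ × ℕ} (hc : Rem L c) (_hs : StepC v v')
    (hv : v' ∈ L) (hne : v' ≠ c) {x : ℕ × ℕ} (hx : x.1 ≤ v'.1 ∧ x.2 ≤ v'.2) : x ≠ c := by
  rintro rfl
  exact hne (hc.max hL hv hx.1 hx.2)

lemma EM.mem_of {L D D' : Finset (ℕ × ℕ)} (hL : Shp L) (h : EM L D D') (hD : D' ⊆ L) : D ⊆ L := by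
  obtain ⟨v, v', hs, hv, hr, rfl⟩ := h
  intro x hx
  by_cases hxv : x = v
  · subst hxv
    have h1 := hr (x.1, x.2 + 1) (by
      have := hs.lt
      refine ⟨le_rfl, ?_, ?_, ?_, ?_, ?_⟩ <;> simp [Prod.ext_iff] <;> omega)
    have h2 := hs.lt
    have h3 := (hr v' hs.rect).1
    exact hL.nw h3 (hL.val h1.1).1 h2.1 (by omega) (by omega)
  · exact hD (by simp [hx, hxv])

lemma reach_sub {L M D : Finset (ℕ × ℕ)} (hL : Shp L) (h : Relation.ReflTransGen (EM L) M D)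
    (hD : D ⊆ L) : M ⊆ L := by
  induction h with
  | refl => exact hD
  | tail _ h2 ih => exact ih (h2.mem_of hL hD)

lemma EM.mono {L L' : Finset (ℕ × ℕ)} (hLL : L ⊆ L') {D D' : Finset (ℕ × ℕ)} (h : EM L D D') :
    EM L' D D' := by
  obtain ⟨v, v', hs, hv, hr, rfl⟩ := h
  exact ⟨v, v', hs, hv, fun x hx => ⟨hLL (hr x hx).1, (hr x hx).2⟩, rfl⟩

lemma reach_erase_iff {L M D : Finset (ℕ × ℕ)} (hL : Shp L) {c : ℕ × ℕ} (hc : Rem L c)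
    (hcD : c ∉ D) :
    Relation.ReflTransGen (EM L) M D ↔ Relation.ReflTransGen (EM (L.erase c)) M D := by
  constructor
  · intro h
    induction h with
    | refl => exact .refl
    | @tail D D' _ h2 ih =>
      obtain ⟨v, v', hs, hv, hr, rfl⟩ := h2
      have hv' := (hr v' hs.rect).1
      have hlt := hs.lt
      have hne : v' ≠ c := by rintro rfl; simp at hcD
      have hvc : v ≠ c := rect_ne hL hc hs hv' hne (by omega)
      have hcD' : c ∉ D := by
        intro h; apply hcD; simp [h, hvc.symm]
      refine (ih hcD').tail ⟨v, v', hs, hv, fun x hx => ⟨?_, (hr x hx).2⟩, rfl⟩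
      rw [Finset.mem_erase]
      exact ⟨rect_ne hL hc hs hv' hne ⟨hx.2.1, hx.2.2.2.1⟩, (hr x hx).1⟩
  · intro h
    exact Relation.ReflTransGen.mono (r := EM (L.erase c)) (p := EM L)
      (fun _ _ => EM.mono (Finset.erase_subset _ _)) _ _ h

def NC (v d : ℕ × ℕ) : Prop :=
  v.1 < v.2 ∧ v.2 + d.1 ≤ d.2 + v.1 + 1 ∧ d.2 + v.1 ≤ v.2 + d.1 + 1 ∧
    (v.2 = v.1 + 1 → d.2 = d.1 + 1 → v.1 % 2 = d.1 % 2)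

def Free (D : Finset (ℕ × ℕ)) (d : ℕ × ℕ) : Prop :=
  ∀ v ∈ D, v ≠ d → NC v d → v.1 ≤ d.1 ∧ v.2 ≤ d.2

lemma StepC.nc {v v' x : ℕ × ℕ} (h : StepC v v') : NC x v ↔ NC x v' := by
  obtain ⟨i, j⟩ := v
  rcases h with ⟨h0, rfl⟩ | ⟨h0, rfl⟩ <;> simp [NC] at * <;> omega

lemma StepC.nc' {v v' x : ℕ × ℕ} (h : StepC v v') : NC v x ↔ NC v' x := by
  obtain ⟨i, j⟩ := v
  rcases h with ⟨h0, rfl⟩ | ⟨h0, rfl⟩ <;> simp [NC] at * <;> omega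

lemma StepC.col {v v' : ℕ × ℕ} (h : StepC v v') : col v = col v' := by
  rw [col_eq h.lt.1 h.lt.2.2.2.2.1]
  obtain ⟨i, j⟩ := v
  rcases h with ⟨h0, rfl⟩ | ⟨h0, rfl⟩ <;> simp at * <;> omega

lemma rect_of_nc {v v' x : ℕ × ℕ} (h : StepC v v') (hn : NC x v) (h1 : x.1 ≤ v'.1 ∧ x.2 ≤ v'.2)
    (h2 : ¬ (x.1 ≤ v.1 ∧ x.2 ≤ v.2)) : Rect v v' x := by
  obtain ⟨i, j⟩ := v
  obtain ⟨a, b⟩ := x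
  rcases h with ⟨h0, rfl⟩ | ⟨h0, rfl⟩ <;> simp [NC, Rect] at * <;> omega

lemma reach_free {L M D : Finset (ℕ × ℕ)} (hL : Shp L) (hM : Shp M) {c : ℕ × ℕ} (hc : Rem L c)
    (h : Relation.ReflTransGen (EM L) M D) :
    ∀ d ∈ D, d ∈ L → col d = col c → Free D d →
      ∃ b, Rem M b ∧ col b = col c ∧
        Relation.ReflTransGen (EM (L.erase c)) (M.erase b) (D.erase d) := by
  induction h with
  | refl =>
    intro d hd hdL hcol hf
    have vd := hL.val hdL
    refine ⟨d, ⟨hd, fun h => ?_, fun h => ?_⟩, hcol, .refl⟩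
    · have := hM.val h
      have := hf _ h (by simp [Prod.ext_iff]) (by simp [NC] at *; omega)
      simp at this
    · have := hM.val h
      have := hf _ h (by simp [Prod.ext_iff]) (by simp [NC] at *; omega)
      simp at this
  | @tail D D' _ h2 ih =>
    obtain ⟨v, v', hs, hv, hr, rfl⟩ := h2
    have hv' := (hr v' hs.rect)
    have hlt := hs.lt
    intro d hd hdL hcol hf
    by_cases hdv : d = v'
    · subst hdv
      have h1v : 1 ≤ v.1 := by
        have h1 := hr (v.1, v.2 + 1) (by
          refine ⟨le_rfl, ?_, ?_, ?_, ?_, ?_⟩ <;> simp [Prod.ext_iff] <;> omega)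
        exact (hL.val h1.1).1
      have := ih v hv (hL.nw hdL h1v hlt.1 (by omega) (by omega)) (by rw [hs.col, hcol]) ?_
      · obtain ⟨b, hb1, hb2, hb3⟩ := this
        refine ⟨b, hb1, hb2, ?_⟩
        rwa [Finset.erase_insert]
        simp [hv'.2]
      · intro x hx hxv hnc
        by_contra hcon
        have hxd : x ≠ d := by rintro rfl; exact hv'.2 hx
        have := hf x (by simp [hx, hxv]) hxd (hs.nc.1 hnc)
        exact (hr x (rect_of_nc hs hnc this hcon)).2 hx
    · have hdD : d ∈ D ∧ d ≠ v := by
        rw [Finset.mem_insert, Finset.mem_erase] at hd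
        tauto
      have := ih d hdD.1 hdL hcol ?_
      · obtain ⟨b, hb1, hb2, hb3⟩ := this
        refine ⟨b, hb1, hb2, hb3.tail ?_⟩
        have hne : v' ≠ c := by
          rintro rfl
          have := hc.le_of_col hL hdL hcol
          have vd := hL.val hdL
          have h3 := (col_eq vd.2 hlt.2.2.2.2.1).1 hcol
          have := hf v' (by simp) (Ne.symm hdv) (by simp only [NC]; omega)
          exact hdv (Prod.ext (by omega) (by omega))
        refine ⟨v, v', hs, by simp [hv, hdD.2.symm], fun x hx => ⟨?_, ?_⟩, ?_⟩
        · rw [Finset.mem_erase]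
          exact ⟨rect_ne hL hc hs hv'.1 hne ⟨hx.2.1, hx.2.2.2.1⟩, (hr x hx).1⟩
        · have := (hr x hx).2
          simp [this]
        · rw [Finset.erase_insert_of_ne (Ne.symm hdv), Finset.erase_right_comm]
      · intro x hx hxd hnc
        by_cases hxv : x = v
        · subst hxv
          have := hf v' (by simp) (Ne.symm hdv) (hs.nc'.1 hnc)
          omega
        · exact hf x (by simp [hx, hxv]) hxd hnc

lemma reach_slide {L A : Finset (ℕ × ℕ)} (hL : Shp L) {c : ℕ × ℕ} (hc : c ∈ L) (k : ℕ) :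
    ∀ b : ℕ × ℕ, c.1 - b.1 = k → b.1 ≤ c.1 → 1 ≤ b.1 → b.1 < b.2 → col b = col c →
      (∀ x ∈ A, ¬ (b.1 ≤ x.1 ∧ b.2 ≤ x.2)) →
      Relation.ReflTransGen (EM L) (insert b A) (insert c A) := by
  have vc := hL.val hc
  induction k using Nat.strong_induction_on with
  | _ k ih =>
    intro b hk hle h1 h2 hcol hA
    have h3 := (col_eq h2 vc.2).1 hcol
    by_cases hk0 : b.1 = c.1
    · have : b = c := Prod.ext hk0 (by omega)
      subst this
      exact .refl
    · obtain ⟨v', hs, hv1⟩ : ∃ v', StepC b v' ∧ v'.1 ≤ c.1 := by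
        by_cases hd : b.2 = b.1 + 1
        · exact ⟨(b.1 + 2, b.2 + 2), Or.inr ⟨hd, rfl⟩, by simp; omega⟩
        · exact ⟨(b.1 + 1, b.2 + 1), Or.inl ⟨by omega, rfl⟩, by simp; omega⟩
      have hlt := hs.lt
      refine Relation.ReflTransGen.head ?_
        (ih (c.1 - v'.1) (by omega) v' rfl hv1 (by omega) (by omega) (by rw [← hs.col, hcol]) ?_)
      · refine ⟨b, v', hs, by simp, fun x hx => ⟨?_, ?_⟩, ?_⟩
        · obtain ⟨r1, r2, r3, r4, r5, r6⟩ := hx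
          exact hL.nw hc (by omega) r5 (by omega) (by omega)
        · obtain ⟨r1, r2, r3, r4, r5, r6⟩ := hx
          rw [Finset.mem_insert, not_or]
          exact ⟨r6, fun h => hA x h ⟨r1, r3⟩⟩
        · rw [Finset.erase_insert]
          intro h; exact hA b h ⟨le_rfl, le_rfl⟩
      · intro x hx hcon
        exact hA x hx ⟨by omega, by omega⟩

lemma reach_insert {L A D : Finset (ℕ × ℕ)} {c : ℕ × ℕ} (hcA : c ∉ A)
    (h : Relation.ReflTransGen (EM (L.erase c)) A D) :
    c ∉ D ∧ Relation.ReflTransGen (EM L) (insert c A) (insert c D) := by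
  induction h with
  | refl => exact ⟨hcA, .refl⟩
  | @tail D D' _ h2 ih =>
    obtain ⟨hcD, h1⟩ := ih
    obtain ⟨v, v', hs, hv, hr, rfl⟩ := h2
    have hv' := (hr v' hs.rect)
    have hne : c ≠ v' := by rintro rfl; simp at hv'
    have hvc : c ≠ v := by rintro rfl; exact hcD hv
    refine ⟨by simp [hne, hcD], h1.tail ⟨v, v', hs, by simp [hv], fun x hx => ?_, ?_⟩⟩
    · have := hr x hx
      rw [Finset.mem_erase] at this
      refine ⟨this.1.2, ?_⟩
      simp [this.1.1, this.2]
    · rw [Finset.erase_insert_of_ne hvc, Finset.insert_comm]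

noncomputable def Exc (L M : Finset (ℕ × ℕ)) : Finset (Finset (ℕ × ℕ)) :=
  L.powerset.filter (fun D => Relation.ReflTransGen (EM L) M D)

lemma mem_Exc {L M D : Finset (ℕ × ℕ)} :
    D ∈ Exc L M ↔ D ⊆ L ∧ Relation.ReflTransGen (EM L) M D := by
  simp [Exc]

lemma Exc_notMem {L M D : Finset (ℕ × ℕ)} (hL : Shp L) {c : ℕ × ℕ} (hc : Rem L c) :
    (D ∈ Exc L M ∧ c ∉ D) ↔ D ∈ Exc (L.erase c) M := by
  rw [mem_Exc, mem_Exc, Finset.subset_erase]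
  constructor
  · rintro ⟨⟨h1, h2⟩, h3⟩
    exact ⟨⟨h1, h3⟩, (reach_erase_iff hL hc h3).1 h2⟩
  · rintro ⟨⟨h1, h3⟩, h2⟩
    exact ⟨⟨h1, (reach_erase_iff hL hc h3).2 h2⟩, h3⟩

lemma Exc_mem {L M D : Finset (ℕ × ℕ)} (hL : Shp L) (hM : Shp M) {c : ℕ × ℕ} (hc : Rem L c)
    (h : D ∈ Exc L M) (hcD : c ∈ D) :
    ∃ b, Rem M b ∧ col b = col c ∧ D.erase c ∈ Exc (L.erase c) (M.erase b) := by
  rw [mem_Exc] at h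
  obtain ⟨b, h1, h2, h3⟩ := reach_free hL hM hc h.2 c hcD hc.1 rfl (by
    intro x hx hxc hnc
    by_contra hcon
    have vx := hL.val (h.1 hx)
    have vc := hL.val hc.1
    simp only [NC] at hnc
    exact hxc (hc.max hL (h.1 hx) (by omega) (by omega)))
  refine ⟨b, h1, h2, ?_⟩
  rw [mem_Exc]
  exact ⟨Finset.erase_subset_erase _ h.1, h3⟩

lemma Exc_insert {L M D : Finset (ℕ × ℕ)} (hL : Shp L) (hM : Shp M) {c b : ℕ × ℕ} (hc : Rem L c)
    (hb : Rem M b) (hcol : col b = col c) (h : D ∈ Exc (L.erase c) (M.erase b)) :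
    insert c D ∈ Exc L M := by
  rw [mem_Exc] at h ⊢
  have hsub := reach_sub (hL.erase hc) h.2 h.1
  refine ⟨Finset.insert_subset hc.1 (h.1.trans (Finset.erase_subset _ _)), ?_⟩
  have hcA : c ∉ M.erase b := fun h => by simpa using hsub h
  have h2 := (reach_insert hcA h.2).2
  have vb := hM.val hb.1
  have vc := hL.val hc.1
  have hcb := (col_eq vb.2 vc.2).1 hcol
  have hle : b.1 ≤ c.1 := by
    by_contra hlt
    have h5 : (c.1, c.2 + 1) ∈ M.erase b := by
      rw [Finset.mem_erase]
      refine ⟨by simp [Prod.ext_iff]; omega, hM.nw hb.1 vc.1 (by simp; omega) (by simp; omega)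
        (by simp; omega)⟩
    exact hc.2.2 (Finset.mem_of_mem_erase (hsub h5))
  have h1 := reach_slide (A := M.erase b) hL hc.1 _ b rfl hle vb.1 vb.2 hcol (by
    intro x hx hcon
    rw [Finset.mem_erase] at hx
    exact hx.1 (hb.max hM hx.2 hcon.1 hcon.2))
  rw [Finset.insert_erase hb.1] at h1
  exact h1.trans h2


noncomputable def sig (a : ℕ) : ℝ := if a % 2 = 1 then -1 else 1

noncomputable def sY (k : ℕ) (Y : ℕ → ℝ) : ℕ → ℝ := fun n =>
  if k = 0 then (if n = 0 then -Y 1 else if n = 1 then -Y 0 else Y n)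
  else (if n = k then Y (k - 1) else if n = k - 1 then Y k else Y n)

noncomputable def al (k : ℕ) (Y : ℕ → ℝ) : ℝ := if k = 0 then Y 1 + Y 0 else Y k - Y (k - 1)

noncomputable def Zw (S : Finset (ℕ × ℕ)) (Y : ℕ → ℝ) : ℝ := ∑ v ∈ S, al (col v) Y

noncomputable def len (S : Finset (ℕ × ℕ)) (i : ℕ) : ℕ := (S.filter (fun p => p.1 = i)).card
noncomputable def tl (S : Finset (ℕ × ℕ)) (j : ℕ) : ℕ := (S.filter (fun p => p.2 = j)).card

lemma ivl (R : Finset ℕ) (a : ℕ) (h1 : ∀ j ∈ R, a < j) (h2 : ∀ j, j + 1 ∈ R → a < j → j ∈ R) :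
    ∀ j, j ∈ R ↔ a < j ∧ j ≤ a + R.card := by
  have key : ∀ k j, j + k ∈ R → a < j → j ∈ R := by
    intro k
    induction k with
    | zero => intro j h _; exact h
    | succ k ih => intro j h h'; exact ih j (h2 _ h (by omega)) h'
  rcases R.eq_empty_or_nonempty with rfl | hne
  · intro j
    simp only [Finset.notMem_empty, Finset.card_empty, false_iff]
    omega
  · have hm := R.max'_mem hne
    have hR : R = Finset.Ioc a (R.max' hne) := by
      ext j
      rw [Finset.mem_Ioc]
      constructor
      · intro h; exact ⟨h1 j h, R.le_max' j h⟩
      · rintro ⟨h, h'⟩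
        obtain ⟨k, hk⟩ := Nat.exists_eq_add_of_le h'
        exact key k j (hk ▸ hm) h
    have hcard : R.card = R.max' hne - a := by
      conv_lhs => rw [hR]
      simp
    have := h1 _ hm
    intro j
    conv_lhs => rw [hR]
    rw [Finset.mem_Ioc, hcard]
    omega

lemma mem_len {S : Finset (ℕ × ℕ)} (hS : Shp S) (i j : ℕ) :
    (i, j) ∈ S ↔ 1 ≤ i ∧ i < j ∧ j ≤ i + len S i := by
  have hcard : ((S.filter (fun p => p.1 = i)).image Prod.snd).card = len S i := by
    rw [Finset.card_image_of_injOn, len]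
    rintro ⟨a, b⟩ h ⟨c, d⟩ h' heq
    simp at *
    exact ⟨h.2.trans h'.2.symm, heq⟩
  have hmem : ∀ j, j ∈ (S.filter (fun p => p.1 = i)).image Prod.snd ↔ (i, j) ∈ S := by
    intro j; simp
  have := ivl ((S.filter (fun p => p.1 = i)).image Prod.snd) i
    (by intro j hj; rw [hmem] at hj; exact (hS.val hj).2)
    (by intro j hj h; rw [hmem] at *; exact hS.2.2 _ _ hj h) j
  rw [hmem, hcard] at this
  constructor
  · intro h; exact ⟨(hS.val h).1, this.1 h⟩
  · intro h; exact this.2 h.2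

lemma mem_tl {S : Finset (ℕ × ℕ)} (hS : Shp S) (i j : ℕ) :
    (i, j) ∈ S ↔ 1 ≤ i ∧ i ≤ tl S j := by
  have hcard : ((S.filter (fun p => p.2 = j)).image Prod.fst).card = tl S j := by
    rw [Finset.card_image_of_injOn, tl]
    rintro ⟨a, b⟩ h ⟨c, d⟩ h' heq
    simp at *
    exact ⟨heq, h.2.trans h'.2.symm⟩
  have hmem : ∀ i, i ∈ (S.filter (fun p => p.2 = j)).image Prod.fst ↔ (i, j) ∈ S := by
    intro j; simp
  have := ivl ((S.filter (fun p => p.2 = j)).image Prod.fst) 0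
    (by intro j hj; rw [hmem] at hj; exact (hS.val hj).1)
    (by intro j hj h; rw [hmem] at *; exact hS.2.1 _ _ hj h) i
  rw [hmem, hcard] at this
  rw [this]; omega

lemma len_erase (S : Finset (ℕ × ℕ)) {c : ℕ × ℕ} (hc : c ∈ S) (i : ℕ) :
    len (S.erase c) i = if i = c.1 then len S i - 1 else len S i := by
  unfold len
  rw [Finset.filter_erase]
  split_ifs with h
  · rw [Finset.card_erase_of_mem (by simp [hc, h])]
  · rw [Finset.erase_eq_of_notMem (by simp [hc, Ne.symm h])]

lemma tl_erase (S : Finset (ℕ × ℕ)) {c : ℕ × ℕ} (hc : c ∈ S) (i : ℕ) :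
    tl (S.erase c) i = if i = c.2 then tl S i - 1 else tl S i := by
  unfold tl
  rw [Finset.filter_erase]
  split_ifs with h
  · rw [Finset.card_erase_of_mem (by simp [hc, h])]
  · rw [Finset.erase_eq_of_notMem (by simp [hc, Ne.symm h])]

noncomputable def Ww (S : Finset (ℕ × ℕ)) (Y : ℕ → ℝ) (j : ℕ) : ℝ :=
  if 0 < len S j then Y (len S j) else if tl S j + 1 = j then - sig j * Y 0
  else - Y (j - 1 - tl S j)

noncomputable def hk (S : Finset (ℕ × ℕ)) (Y : ℕ → ℝ) (u : ℕ × ℕ) : ℝ :=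
  Y (len S u.1) + Ww S Y u.2

lemma sY_other {k : ℕ} {Y : ℕ → ℝ} {n : ℕ} (h : n ≠ k) (h' : n ≠ k - 1)
    (h0 : k = 0 → n ≠ 1) : sY k Y n = Y n := by
  unfold sY
  split_ifs <;> first | rfl | (exfalso; omega)

lemma sY_at {k : ℕ} (Y : ℕ → ℝ) (h : k ≠ 0) : sY k Y k = Y (k - 1) := by
  simp [sY, h]

lemma sY_pred {k : ℕ} (Y : ℕ → ℝ) (h : k ≠ 0) : sY k Y (k - 1) = Y k := by
  unfold sY
  rw [if_neg h, if_neg (by omega), if_pos rfl]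

lemma sY_mod0 (r : ℕ) (Y : ℕ → ℝ) : sY (r % 2) Y 0 = - sig r * Y 1 := by
  rcases Nat.mod_two_eq_zero_or_one r with h | h <;> simp [sY, sig, h]

lemma sY_mod1 (r : ℕ) (Y : ℕ → ℝ) : sY (r % 2) Y 1 = - sig r * Y 0 := by
  rcases Nat.mod_two_eq_zero_or_one r with h | h <;> simp [sY, sig, h]

lemma al_mod (r : ℕ) (Y : ℕ → ℝ) : al (r % 2) Y = Y 1 + sig r * Y 0 := by
  rcases Nat.mod_two_eq_zero_or_one r with h | h <;> simp [al, sig, h]; ring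

lemma sig_succ (r : ℕ) : sig (r + 1) = - sig r := by
  unfold sig
  split_ifs <;> first | (exfalso; omega) | norm_num

lemma sig_sq (r : ℕ) : sig r * sig r = 1 := by
  unfold sig
  split_ifs <;> norm_num

lemma sY_mod_other (r : ℕ) (Y : ℕ → ℝ) {n : ℕ} (h : 2 ≤ n) : sY (r % 2) Y n = Y n :=
  sY_other (by omega) (by omega) (by omega)

lemma corner_facts {L : Finset (ℕ × ℕ)} (hL : Shp L) {c : ℕ × ℕ} (hc : Rem L c) :
    1 ≤ c.1 ∧ c.1 < c.2 ∧ c.2 = c.1 + len L c.1 ∧ tl L c.2 = c.1 ∧ len L c.2 = 0 := by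
  have vc := hL.val hc.1
  obtain ⟨r, q⟩ := c
  obtain ⟨h1, h2, h3⟩ := hc
  simp only at *
  have a1 := (mem_len hL _ _).1 h1
  have a2 := (mem_len hL _ _).not.1 h3
  have b1 := (mem_tl hL _ _).1 h1
  have b2 := (mem_tl hL _ _).not.1 h2
  refine ⟨vc.1, vc.2, by omega, by omega, ?_⟩
  by_contra hcon
  have c1 := (mem_len hL q (q + 1)).2 (by omega)
  exact h3 (hL.nw c1 vc.1 (by simp; omega) (by simp; omega) (by simp))

lemma len_le {L : Finset (ℕ × ℕ)} (hL : Shp L) {i i' : ℕ} (h1 : 1 ≤ i) (h : i ≤ i')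
    (h' : 0 < len L i') : i' + len L i' ≤ i + len L i := by
  have := (mem_len hL i' (i' + len L i')).2 (by omega)
  exact ((mem_len hL i _).1 (hL.nw this h1 (by simp; omega) h le_rfl)).2.2

/-- rows -/
lemma row_tr {L : Finset (ℕ × ℕ)} (hL : Shp L) {c : ℕ × ℕ} (hc : Rem L c) (Y : ℕ → ℝ) {i : ℕ}
    (hi : 1 ≤ i) (hlen : 0 < len (L.erase c) i) :
    Y (len L i) = sY (col c) Y (len (L.erase c) i) := by
  obtain ⟨c1, c2, c3, c4, c5⟩ := corner_facts hL hc
  have hE := hL.erase hc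
  have e1 := len_erase L hc.1 i
  by_cases hir : i = c.1
  · rw [if_pos hir] at e1
    have hcol : col c = len L i := by
      have hl : len L i = len L c.1 := by rw [hir]
      unfold col; rw [if_neg (by omega)]; omega
    rw [hcol, e1, sY_pred _ (by omega)]
  · rw [if_neg hir] at e1
    rw [e1] at hlen ⊢
    have e2 := len_erase L hc.1 c.1
    rw [if_pos rfl] at e2
    have hne : len L i ≠ len L c.1 ∧ len L i + 1 ≠ len L c.1 ∧ (len L c.1 = 1 → 2 ≤ len L i) := by
      rcases Nat.lt_or_ge i c.1 with hlt | hge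
      · have := len_le hL hi hlt.le (by omega)
        omega
      · have h3 : 1 < len L c.1 := by
          have := len_le hL c1 hge hlen
          omega
        have := len_le hE c1 hge (by omega)
        omega
    unfold col
    split_ifs with hd
    · rw [sY_mod_other _ _ (by omega)]
    · rw [sY_other (by omega) (by omega) (by omega)]

lemma W_tr {L : Finset (ℕ × ℕ)} (hL : Shp L) {c : ℕ × ℕ} (hc : Rem L c) (Y : ℕ → ℝ) {j : ℕ}
    (hj : 2 ≤ j) (htl : 0 < tl (L.erase c) j) :
    Ww L Y j = Ww (L.erase c) (sY (col c) Y) j := by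
  obtain ⟨c1, c2, c3, c4, c5⟩ := corner_facts hL hc
  have hE := hL.erase hc
  have e1 := len_erase L hc.1 j
  have e2 := tl_erase L hc.1 j
  by_cases h0 : 0 < len (L.erase c) j
  · have h0' : 0 < len L j := by split_ifs at e1 <;> omega
    simp only [Ww, h0, h0', if_true]
    exact row_tr hL hc Y (by omega) h0
  · by_cases h0' : 0 < len L j
    · -- new row
      have hjr : j = c.1 := by
        by_contra hne; rw [if_neg hne] at e1; omega
      subst hjr
      rw [if_pos rfl] at e1
      rw [if_neg (by omega)] at e2
      have h1 : len L c.1 = 1 := by omega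
      have h2 : (c.1 - 1, c.1) ∈ L := hL.nw hc.1 (by simp; omega) (by simp; omega) (by simp)
        (by simp; omega)
      have h3 := (mem_tl hL _ _).1 h2
      have h4 : ¬ (c.1 ≤ tl L c.1) := fun h =>
        absurd (hL.val ((mem_tl hL c.1 c.1).2 ⟨c1, h⟩)).2 (by simp)
      simp only [Ww, h0, h0', if_true, if_false]
      rw [if_pos (by omega), h1]
      unfold col
      rw [if_pos (by omega), sY_mod0]
      linear_combination (-Y 1) * sig_sq c.1
    · simp only [Ww, h0, h0', if_false]
      have htlt : tl L j < j := by
        by_contra hcon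
        exact absurd (hL.val ((mem_tl hL j j).2 ⟨by omega, by omega⟩)).2 (by simp)
      by_cases hjq : j = c.2
      · subst hjq
        rw [if_pos rfl] at e2
        rw [e2, c4, if_neg (by omega : ¬ c.1 - 1 + 1 = c.2)]
        unfold col
        split_ifs with h1 h2 h2
        · rw [show c.2 - 1 - (c.1 - 1) = 1 by omega, sY_mod1, h2, sig_succ]
          ring
        · omega
        · omega
        · rw [show c.2 - 1 - (c.1 - 1) = c.2 - c.1 by omega, sY_at _ (by omega),
            show c.2 - 1 - c.1 = c.2 - c.1 - 1 by omega]
      · rw [if_neg hjq] at e2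
        rw [e2] at htl ⊢
        have m1 : (tl L j, j) ∈ L := (mem_tl hL _ _).2 ⟨htl, le_rfl⟩
        have m2 : (tl L j + 1, j) ∉ L := by
          rw [mem_tl hL]; omega
        have n1 : ¬ (c.1 ≤ tl L j ∧ c.2 ≤ j) := by
          rintro ⟨h1, h2⟩
          have := hc.max hL m1 h1 h2
          rw [← this] at hjq; simp at hjq
        have n2 : ¬ (tl L j + 1 ≤ c.1 ∧ j ≤ c.2 ∧ tl L j + 1 < j) := by
          rintro ⟨h1, h2, h3⟩
          exact m2 (hL.nw hc.1 (by simp) h3 h1 h2)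
        split_ifs with h1
        · have : col c ≠ 0 ∧ col c ≠ 1 := by
            unfold col
            split_ifs with hd
            · exfalso
              have hn3 : j ≤ c.1 := by omega
              by_cases hjr : j = c.1
              · rw [← hjr] at c3; omega
              · have : (j, j + 1) ∈ L := hL.nw hc.1 (by simp; omega) (by simp) (by simp; omega)
                  (by simp; omega)
                have := (mem_len hL _ _).1 this
                omega
            · omega
          rw [sY_other (by omega) (by omega) (by omega)]
        · unfold col
          split_ifs with hd
          · rw [sY_mod_other _ _ (by omega)]
          · rw [sY_other (by omega) (by omega) (by omega)]

lemma hk_tr {L : Finset (ℕ × ℕ)} (hL : Shp L) {c : ℕ × ℕ} (hc : Rem L c) (Y : ℕ → ℝ) {u : ℕ × ℕ}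
    (hu : u ∈ L.erase c) : hk L Y u = hk (L.erase c) (sY (col c) Y) u := by
  have hE := hL.erase hc
  have vu := hE.val hu
  have h1 := (mem_len hE u.1 u.2).1 hu
  have h2 := (mem_tl hE u.1 u.2).1 hu
  unfold hk
  rw [row_tr hL hc Y vu.1 (by omega), W_tr hL hc Y (by omega) (by omega)]

lemma hk_corner {L : Finset (ℕ × ℕ)} (hL : Shp L) {c : ℕ × ℕ} (hc : Rem L c) (Y : ℕ → ℝ) :
    hk L Y c = al (col c) Y := by
  obtain ⟨c1, c2, c3, c4, c5⟩ := corner_facts hL hc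
  unfold hk Ww col
  rw [if_neg (by omega), c4]
  split_ifs with h1 h2 h2
  · rw [al_mod, ← h1, sig_succ, show len L c.1 = 1 by omega]; ring
  · omega
  · omega
  · unfold al
    rw [if_neg (by omega), show len L c.1 = c.2 - c.1 by omega,
      show c.2 - 1 - c.1 = c.2 - c.1 - 1 by omega]; ring


lemma Shp.insert {S : Finset (ℕ × ℕ)} (h : Shp S) {r q : ℕ} (h1 : 1 ≤ r) (h2 : r < q)
    (h3 : 2 ≤ r → (r - 1, q) ∈ S) (h4 : r + 1 < q → (r, q - 1) ∈ S) :
    Shp (insert (r, q) S) := by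
  refine ⟨fun i j hij => ?_, fun i j hij hi => ?_, fun i j hij hi => ?_⟩
  · rw [Finset.mem_insert, Prod.mk.injEq] at hij
    rcases hij with ⟨rfl, rfl⟩ | hij
    · exact ⟨h1, h2⟩
    · exact h.1 i j hij
  · rw [Finset.mem_insert, Prod.mk.injEq] at hij
    rw [Finset.mem_insert]; right
    rcases hij with ⟨rfl, rfl⟩ | hij
    · exact h3 (by omega)
    · exact h.2.1 i j hij hi
  · rw [Finset.mem_insert, Prod.mk.injEq] at hij
    rw [Finset.mem_insert]; right
    rcases hij with ⟨rfl, rfl⟩ | hij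
    · exact h4 (by omega)
    · exact h.2.2 i j hij hi

lemma Shp.union {S T : Finset (ℕ × ℕ)} (h : Shp S) (h' : Shp T) : Shp (S ∪ T) := by
  refine ⟨fun i j hij => ?_, fun i j hij hi => ?_, fun i j hij hi => ?_⟩ <;>
  rw [Finset.mem_union] at *
  · exact hij.elim (h.1 i j) (h'.1 i j)
  · exact hij.imp (fun x => h.2.1 i j x hi) (fun x => h'.2.1 i j x hi)
  · exact hij.imp (fun x => h.2.2 i j x hi) (fun x => h'.2.2 i j x hi)

lemma exists_nrow {S : Finset (ℕ × ℕ)} (hS : Shp S) :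
    ∃ N, ∀ i, 1 ≤ i → (0 < len S i ↔ i ≤ N) := by
  have hmem : ∀ i, i ∈ (S.filter (fun p => p.2 = p.1 + 1)).image Prod.fst ↔ (i, i + 1) ∈ S := by
    intro i; simp
  refine ⟨((S.filter (fun p => p.2 = p.1 + 1)).image Prod.fst).card, fun i hi => ?_⟩
  have := ivl ((S.filter (fun p => p.2 = p.1 + 1)).image Prod.fst) 0
    (by intro j hj; rw [hmem] at hj; exact (hS.val hj).1)
    (by intro j hj h; rw [hmem] at *; exact hS.nw hj h (by simp) (by simp) (by simp)) i
  rw [hmem, mem_len hS] at this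
  omega

lemma row_sum (Y : ℕ → ℝ) (i n : ℕ) :
    ∑ t ∈ Finset.range (n + 1), al (col (i, i + 1 + t)) Y = Y (n + 1) + sig i * Y 0 := by
  induction n with
  | zero => simp [col, al_mod]
  | succ n ih =>
    rw [Finset.sum_range_succ, ih]
    have : col (i, i + 1 + (n + 1)) = n + 2 := by
      unfold col; simp only; rw [if_neg (by omega)]; omega
    rw [this, al, if_neg (by omega)]
    simp only [show n + 2 - 1 = n + 1 by omega, show n + 1 + 1 = n + 2 by omega]
    ring

lemma sum_sig (N : ℕ) : ∑ i ∈ Finset.Ioc 0 N, sig i = if N % 2 = 1 then -1 else 0 := by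
  induction N with
  | zero => simp
  | succ N ih =>
    rw [Finset.sum_Ioc_succ_top (by omega), ih]
    unfold sig
    split_ifs <;> first | (exfalso; omega) | norm_num

lemma Zw_rows {S : Finset (ℕ × ℕ)} (hS : Shp S) {N : ℕ}
    (hN : ∀ i, 1 ≤ i → (0 < len S i ↔ i ≤ N)) (Y : ℕ → ℝ) :
    Zw S Y = ∑ i ∈ Finset.Ioc 0 N, (Y (len S i) + sig i * Y 0) := by
  unfold Zw
  rw [← Finset.sum_fiberwise_of_maps_to (g := Prod.fst) (t := Finset.Ioc 0 N)]
  · refine Finset.sum_congr rfl fun i hi => ?_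
    rw [Finset.mem_Ioc] at hi
    have hpos := (hN i hi.1).2 hi.2
    obtain ⟨n, hn⟩ := Nat.exists_eq_add_of_le' hpos
    have : S.filter (fun p => p.1 = i) =
        (Finset.range (len S i)).image (fun t => (i, i + 1 + t)) := by
      ext ⟨a, b⟩
      simp only [Finset.mem_filter, Finset.mem_image, Finset.mem_range, Prod.mk.injEq]
      rw [mem_len hS]
      constructor
      · rintro ⟨h, rfl⟩
        exact ⟨b - a - 1, by omega, rfl, by omega⟩
      · rintro ⟨t, h, rfl, rfl⟩
        exact ⟨⟨by omega, by omega, by omega⟩, rfl⟩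
    rw [this, Finset.sum_image (by intro a _ b _ h; simpa using h), hn, row_sum]
  · rintro ⟨i, j⟩ hp
    have := (mem_len hS _ _).1 hp
    rw [Finset.mem_Ioc]
    exact ⟨this.1, (hN i this.1).1 (by omega)⟩

lemma len_inj {S : Finset (ℕ × ℕ)} (hS : Shp S) {i i' : ℕ} (h1 : 1 ≤ i) (h1' : 1 ≤ i')
    (h : 0 < len S i) (heq : len S i = len S i') : i = i' := by
  rcases le_total i i' with hle | hle
  · have := len_le hS h1 hle (by omega); omega
  · have := len_le hS h1' hle (by omega); omega

lemma exists_maya {S : Finset (ℕ × ℕ)} (hS : Shp S) : ∃ N, ∃ M : Finset ℕ,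
    (∀ i, 1 ≤ i → (0 < len S i ↔ i ≤ N)) ∧ (∀ Y : ℕ → ℝ, Zw S Y = ∑ p ∈ M, Y p - Y 0) ∧
    (∀ p, 1 ≤ p → (p ∈ M ↔ ∃ i, 1 ≤ i ∧ len S i = p)) ∧ (0 ∈ M ↔ N % 2 = 0) := by
  obtain ⟨N, hN⟩ := exists_nrow hS
  have h0 : 0 ∉ (Finset.Ioc 0 N).image (len S) := by
    simp only [Finset.mem_image, Finset.mem_Ioc, not_exists, not_and]
    intro i hi
    have := (hN i hi.1).2 hi.2
    omega
  have hsum : ∀ Y : ℕ → ℝ, ∑ p ∈ (Finset.Ioc 0 N).image (len S), Y p =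
      ∑ i ∈ Finset.Ioc 0 N, Y (len S i) := by
    intro Y
    rw [Finset.sum_image]
    intro a ha b hb h
    simp only [Finset.coe_Ioc, Set.mem_Ioc] at ha hb
    exact len_inj hS ha.1 hb.1 ((hN a ha.1).2 ha.2) h
  have hm : ∀ p, 1 ≤ p → (p ∈ (Finset.Ioc 0 N).image (len S) ↔ ∃ i, 1 ≤ i ∧ len S i = p) := by
    intro p hp
    simp only [Finset.mem_image, Finset.mem_Ioc]
    constructor
    · rintro ⟨i, hi, rfl⟩; exact ⟨i, hi.1, rfl⟩
    · rintro ⟨i, hi, rfl⟩; exact ⟨i, ⟨hi, (hN i hi).1 hp⟩, rfl⟩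
  refine ⟨N, if N % 2 = 1 then (Finset.Ioc 0 N).image (len S)
    else insert 0 ((Finset.Ioc 0 N).image (len S)), hN, fun Y => ?_, fun p hp => ?_, ?_⟩
  · rw [Zw_rows hS hN, Finset.sum_add_distrib, ← Finset.sum_mul, sum_sig]
    split_ifs
    · rw [hsum]; ring
    · rw [Finset.sum_insert h0, hsum]; ring
  · split_ifs
    · exact hm p hp
    · rw [Finset.mem_insert, hm p hp]
      constructor
      · rintro (h | h)
        · omega
        · exact h
      · exact Or.inr
  · split_ifs with h
    · simp only [h0, false_iff]; omega
    · simp; omega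

lemma sY_sub_pos {k : ℕ} (hk : k ≠ 0) (Y : ℕ → ℝ) (p : ℕ) :
    sY k Y p = Y p + (if p = k - 1 then al k Y else 0) - (if p = k then al k Y else 0) := by
  unfold sY al
  rw [if_neg hk, if_neg hk]
  split_ifs with h1 h2 h2
  · omega
  · subst h1; ring
  · rw [h2]; ring
  · ring

lemma sY_sub_zero (Y : ℕ → ℝ) (p : ℕ) :
    sY 0 Y p = Y p - (if p = 0 then al 0 Y else 0) - (if p = 1 then al 0 Y else 0) := by
  unfold sY al
  simp only [if_true]
  split_ifs with h1 h2 h2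
  · omega
  · subst h1; ring
  · rw [h2]; ring
  · ring

lemma maya_pos {S : Finset (ℕ × ℕ)} {M : Finset ℕ}
    (h : ∀ Y : ℕ → ℝ, Zw S Y = ∑ p ∈ M, Y p - Y 0) {k : ℕ} (hk : k ≠ 0) (Y : ℕ → ℝ) :
    Zw S (sY k Y) = Zw S Y + (if k - 1 ∈ M then al k Y else 0) - (if k ∈ M then al k Y else 0)
      - (if k = 1 then al k Y else 0) := by
  rw [h, h, sY_sub_pos hk Y 0]
  simp_rw [sY_sub_pos hk Y]
  rw [Finset.sum_sub_distrib, Finset.sum_add_distrib, Finset.sum_ite_eq', Finset.sum_ite_eq',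
    if_neg (by omega : ¬ 0 = k)]
  by_cases h1 : k = 1
  · rw [if_pos (by omega : 0 = k - 1), if_pos h1]; ring
  · rw [if_neg (by omega : ¬ 0 = k - 1), if_neg h1]; ring

lemma maya_zero {S : Finset (ℕ × ℕ)} {M : Finset ℕ}
    (h : ∀ Y : ℕ → ℝ, Zw S Y = ∑ p ∈ M, Y p - Y 0) (Y : ℕ → ℝ) :
    Zw S (sY 0 Y) = Zw S Y - (if 0 ∈ M then al 0 Y else 0) - (if 1 ∈ M then al 0 Y else 0)
      + al 0 Y := by
  rw [h, h, sY_sub_zero Y 0]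
  simp_rw [sY_sub_zero Y]
  rw [Finset.sum_sub_distrib, Finset.sum_sub_distrib, Finset.sum_ite_eq', Finset.sum_ite_eq']
  simp
  ring

noncomputable def eps (k : ℕ) : ℝ := if k = 1 then 1 else 0

lemma al_sY (k : ℕ) (Y : ℕ → ℝ) : al k (sY k Y) = - al k Y := by
  by_cases hk : k = 0
  · subst hk; simp [al, sY]
  · have := sY_at Y hk
    have := sY_pred Y hk
    simp only [al, hk, if_false, *]; ring

lemma Zw_erase {T : Finset (ℕ × ℕ)} {c : ℕ × ℕ} (hc : c ∈ T) (Y : ℕ → ℝ) :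
    Zw T Y = Zw (T.erase c) Y + al (col c) Y := by
  unfold Zw
  rw [Finset.sum_erase_add _ _ hc]

lemma Zlaw1 {T : Finset (ℕ × ℕ)} (hT : Shp T) {c : ℕ × ℕ} (hc : Rem T c) (Y : ℕ → ℝ) :
    Zw (T.erase c) (sY (col c) Y) = Zw T Y - eps (col c) * al (col c) Y := by
  have hS := hT.erase hc
  obtain ⟨N, M, h1, h2, h3, h4⟩ := exists_maya hS
  obtain ⟨c1, c2, c3, c4, c5⟩ := corner_facts hT hc
  have el := len_erase T hc.1
  have hdis : ∀ i, 1 ≤ i → len (T.erase c) i ≠ len T c.1 := by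
    intro i hi heq
    rw [el] at heq
    split_ifs at heq with h
    · rw [h] at heq; omega
    · exact h (len_inj hT hi c1 (by omega) heq)
  have elc := el c.1
  rw [if_pos rfl] at elc
  rw [Zw_erase hc.1 Y]
  by_cases hd : c.2 = c.1 + 1
  · have hcol : col c = c.1 % 2 := by unfold col; rw [if_pos hd]
    have hNr : N + 1 = c.1 := by
      have a1 := h1 c.1 c1
      by_cases hr : c.1 = 1
      · omega
      · have : 0 < len (T.erase c) (c.1 - 1) := by
          rw [el, if_neg (by omega)]
          have := len_le hT (i := c.1 - 1) (i' := c.1) (by omega) (by omega) (by omega)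
          omega
        have a2 := (h1 (c.1 - 1) (by omega)).1 this
        omega
    have m1 : 1 ∉ M := by
      rw [h3 1 le_rfl]
      rintro ⟨i, hi, h⟩
      apply hdis i hi; omega
    rcases Nat.mod_two_eq_zero_or_one c.1 with h | h
    · rw [hcol, h, maya_zero h2, if_neg m1, if_neg (by rw [h4]; omega), eps, if_neg (by omega)]
      ring
    · rw [hcol, h, maya_pos h2 (by omega), if_pos (by rw [h4]; omega), if_neg m1, eps]
      simp
  · have hcol : col c = c.2 - c.1 := by unfold col; rw [if_neg hd]
    have m1 : c.2 - c.1 ∉ M := by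
      rw [h3 _ (by omega)]
      rintro ⟨i, hi, h⟩
      apply hdis i hi; omega
    have m2 : c.2 - c.1 - 1 ∈ M := by
      rw [h3 _ (by omega)]
      exact ⟨c.1, c1, by omega⟩
    rw [hcol, maya_pos h2 (by omega), if_pos m2, if_neg m1, if_neg (by omega), eps,
      if_neg (by omega)]
    ring

lemma Zlaw2 {T : Finset (ℕ × ℕ)} (hT : Shp T) {c : ℕ × ℕ} (hc : Rem T c) (Y : ℕ → ℝ) :
    Zw T (sY (col c) Y) = Zw T Y - eps (col c) * al (col c) Y - al (col c) Y := by
  rw [Zw_erase hc.1 (sY (col c) Y), Zlaw1 hT hc, al_sY]; ring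

lemma add_newrow {S : Finset (ℕ × ℕ)} (hS : Shp S) {N : ℕ}
    (h1 : ∀ i, 1 ≤ i → (0 < len S i ↔ i ≤ N)) (h : ¬ ∃ i, 1 ≤ i ∧ len S i = 1) :
    Addb S (N + 1, N + 2) ∧ col (N + 1, N + 2) = (N + 1) % 2 := by
  refine ⟨⟨?_, hS.insert (by omega) (by omega) (fun hN => ?_) (by omega)⟩, by simp [col]⟩
  · rw [mem_len hS]
    have := h1 (N + 1) (by omega)
    omega
  · have := (h1 N (by omega)).2 le_rfl
    have : len S N ≠ 1 := fun h' => h ⟨N, by omega, h'⟩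
    rw [mem_len hS]
    simp only [Nat.add_sub_cancel]
    omega

lemma rem_lastrow {S : Finset (ℕ × ℕ)} (hS : Shp S) {N : ℕ}
    (h1 : ∀ i, 1 ≤ i → (0 < len S i ↔ i ≤ N)) (h : ∃ i, 1 ≤ i ∧ len S i = 1) :
    ∃ b, Rem S b ∧ col b = N % 2 := by
  obtain ⟨i, hi, hl⟩ := h
  have a1 := h1 i hi
  have a2 := h1 (i + 1) (by omega)
  have a3 : ¬ 0 < len S (i + 1) := fun h' => by
    have := len_le hS hi (Nat.le_succ i) h'
    simp at this; omega
  have : i = N := by omega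
  subst this
  refine ⟨(i, i + 1), ⟨?_, ?_, ?_⟩, by simp [col]⟩
  · rw [mem_len hS]; omega
  · intro h; have := hS.val h; simp at this
  · simp only; rw [mem_len hS]; omega

lemma Zlaw3 {S : Finset (ℕ × ℕ)} (hS : Shp S) {k : ℕ} (ha : ¬ ∃ a, Addb S a ∧ col a = k)
    (hr : ¬ ∃ b, Rem S b ∧ col b = k) (Y : ℕ → ℝ) :
    Zw S (sY k Y) = Zw S Y - eps k * al k Y := by
  obtain ⟨N, M, h1, h2, h3, h4⟩ := exists_maya hS
  by_cases hk0 : k = 0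
  · subst hk0
    rw [maya_zero h2, eps]
    by_cases hm : 1 ∈ M
    · have := rem_lastrow hS h1 ((h3 1 le_rfl).1 hm)
      rw [if_neg, if_pos hm]
      · simp
      · intro h; rw [h4] at h; rw [h] at this; exact hr this
    · have := add_newrow hS h1 ((h3 1 le_rfl).not.1 hm)
      rw [if_pos, if_neg hm]
      · simp
      · by_contra h
        rw [h4] at h
        exact ha ⟨_, this.1, this.2.trans (by omega)⟩
  by_cases hk1 : k = 1
  · subst hk1
    rw [maya_pos h2 (by omega), eps]
    by_cases hm : 1 ∈ M
    · have := rem_lastrow hS h1 ((h3 1 le_rfl).1 hm)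
      rw [if_pos, if_pos hm]
      · simp
      · by_contra h; change ¬ 0 ∈ M at h; rw [h4] at h; rw [show N % 2 = 1 by omega] at this; exact hr this
    · have := add_newrow hS h1 ((h3 1 le_rfl).not.1 hm)
      rw [if_neg, if_neg hm]
      · simp
      · intro h
        change 0 ∈ M at h
        rw [h4] at h
        exact ha ⟨_, this.1, this.2.trans (by omega)⟩
  · have : k - 1 ∈ M ↔ k ∈ M := by
      constructor
      · intro hm
        by_contra hm'
        rw [h3 _ (by omega)] at hm hm'
        obtain ⟨i, hi, hl⟩ := hm
        apply ha
        refine ⟨(i, i + k), ⟨?_, hS.insert hi (by omega) (fun h => ?_) (fun h => ?_)⟩, ?_⟩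
        · rw [mem_len hS]; omega
        · rw [mem_len hS]
          have := len_le hS (i := i - 1) (i' := i) (by omega) (by omega) (by omega)
          have : len S (i - 1) ≠ k := fun h' => hm' ⟨i - 1, by omega, h'⟩
          omega
        · rw [mem_len hS]; omega
        · unfold col; simp only; rw [if_neg (by omega)]; omega
      · intro hm
        by_contra hm'
        rw [h3 _ (by omega)] at hm hm'
        obtain ⟨i, hi, hl⟩ := hm
        apply hr
        refine ⟨(i, i + k), ⟨?_, ?_, ?_⟩, ?_⟩
        · rw [mem_len hS]; omega
        · simp only; rw [mem_len hS]
          intro h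
          have := len_le hS (i := i) (i' := i + 1) (by omega) (by omega) (by omega)
          have : len S (i + 1) ≠ k - 1 := fun h' => hm' ⟨i + 1, by omega, h'⟩
          omega
        · simp only; rw [mem_len hS]; omega
        · unfold col; simp only; rw [if_neg (by omega)]; omega
    rw [maya_pos h2 hk0, eps, if_neg hk1, if_neg hk1]
    simp only [this]
    ring


noncomputable def EE (L : Finset (ℕ × ℕ)) (Y : ℕ → ℝ) (M : Finset (ℕ × ℕ)) : ℝ :=
  ∑ D ∈ Exc L M, ∏ u ∈ D, hk L Y u

noncomputable def remS (M : Finset (ℕ × ℕ)) (k : ℕ) : Finset (ℕ × ℕ) :=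
  M.filter (fun b => Rem M b ∧ col b = k)

lemma mem_remS {M : Finset (ℕ × ℕ)} {k : ℕ} {b : ℕ × ℕ} : b ∈ remS M k ↔ Rem M b ∧ col b = k := by
  unfold remS
  rw [Finset.mem_filter]
  exact ⟨fun h => h.2, fun h => ⟨h.1.1, h⟩⟩

lemma remS_single {M : Finset (ℕ × ℕ)} (hM : Shp M) {b : ℕ × ℕ} (hb : Rem M b) :
    remS M (col b) = {b} := by
  ext x
  rw [mem_remS, Finset.mem_singleton]
  constructor
  · rintro ⟨h1, h2⟩; exact h1.unique hb hM h2
  · rintro rfl; exact ⟨hb, rfl⟩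

lemma remS_empty {M : Finset (ℕ × ℕ)} {k : ℕ} (h : ¬ ∃ b, Rem M b ∧ col b = k) :
    remS M k = ∅ := by
  ext x
  rw [mem_remS]
  simp only [Finset.notMem_empty, iff_false]
  exact fun h' => h ⟨x, h'⟩

lemma EE_zero {L M : Finset (ℕ × ℕ)} (hL : Shp L) (h : ¬ M ⊆ L) (Y : ℕ → ℝ) : EE L Y M = 0 := by
  unfold EE
  apply Finset.sum_eq_zero
  intro D hD
  rw [mem_Exc] at hD
  exact absurd (reach_sub hL hD.2 hD.1) h

lemma prod_tr {L D : Finset (ℕ × ℕ)} (hL : Shp L) {c : ℕ × ℕ} (hc : Rem L c) (Y : ℕ → ℝ)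
    (hD : D ⊆ L.erase c) :
    ∏ u ∈ D, hk L Y u = ∏ u ∈ D, hk (L.erase c) (sY (col c) Y) u :=
  Finset.prod_congr rfl fun _ hu => hk_tr hL hc Y (hD hu)

lemma EE_rec {L M : Finset (ℕ × ℕ)} (hL : Shp L) (hM : Shp M) {c : ℕ × ℕ} (hc : Rem L c)
    (Y : ℕ → ℝ) :
    EE L Y M = EE (L.erase c) (sY (col c) Y) M +
      al (col c) Y * ∑ b ∈ remS M (col c), EE (L.erase c) (sY (col c) Y) (M.erase b) := by
  have h1 : EE L Y M = ∑ D ∈ (Exc L M).filter (fun D => c ∉ D), ∏ u ∈ D, hk L Y u +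
      ∑ D ∈ (Exc L M).filter (fun D => ¬ c ∉ D), ∏ u ∈ D, hk L Y u := by
    unfold EE
    rw [Finset.sum_filter_add_sum_filter_not]
  have h2 : (Exc L M).filter (fun D => c ∉ D) = Exc (L.erase c) M := by
    ext D
    rw [Finset.mem_filter]
    exact Exc_notMem hL hc
  rw [h1, h2]
  congr 1
  · unfold EE
    refine Finset.sum_congr rfl fun D hD => prod_tr hL hc Y (mem_Exc.1 hD).1
  · by_cases hb : ∃ b, Rem M b ∧ col b = col c
    · obtain ⟨b, hb, hbc⟩ := hb
      rw [← hbc, remS_single hM hb, Finset.sum_singleton, hbc]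
      unfold EE
      rw [Finset.mul_sum]
      have hcn : ∀ D, D ∈ Exc (L.erase c) (M.erase b) → c ∉ D := fun D hD h => by
        have := (mem_Exc.1 hD).1 h
        simp at this
      refine Finset.sum_bij' (fun D _ => D.erase c) (fun D _ => insert c D) ?_ ?_ ?_ ?_ ?_
      · intro D hD
        rw [Finset.mem_filter, not_not] at hD
        obtain ⟨b', e1, e2, e3⟩ := Exc_mem hL hM hc hD.1 hD.2
        rw [hb.unique e1 hM (hbc.trans e2.symm)]
        exact e3
      · intro D hD
        rw [Finset.mem_filter, not_not]
        exact ⟨Exc_insert hL hM hc hb hbc hD, Finset.mem_insert_self _ _⟩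
      · intro D hD
        rw [Finset.mem_filter, not_not] at hD
        exact Finset.insert_erase hD.2
      · intro D hD
        exact Finset.erase_insert (hcn D hD)
      · intro D hD
        rw [Finset.mem_filter, not_not] at hD
        rw [← prod_tr hL hc Y, ← hk_corner hL hc Y, Finset.mul_prod_erase _ _ hD.2]
        exact Finset.erase_subset_erase _ (mem_Exc.1 hD.1).1
    · rw [remS_empty hb, Finset.sum_empty, mul_zero]
      apply Finset.sum_eq_zero
      intro D hD
      rw [Finset.mem_filter, not_not] at hD
      obtain ⟨b', e1, e2, e3⟩ := Exc_mem hL hM hc hD.1 hD.2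
      exact absurd ⟨b', e1, e2⟩ hb

noncomputable def addF (M : Finset (ℕ × ℕ)) : Finset (ℕ × ℕ) :=
  (insert (1, 2) (M.image (fun p => (p.1 + 1, p.2)) ∪ M.image (fun p => (p.1, p.2 + 1)))).filter
    (Addb M)

lemma Addb.val {M : Finset (ℕ × ℕ)} {a : ℕ × ℕ} (h : Addb M a) : 1 ≤ a.1 ∧ a.1 < a.2 :=
  h.2.val (Finset.mem_insert_self _ _)

lemma mem_addF {M : Finset (ℕ × ℕ)} {a : ℕ × ℕ} : a ∈ addF M ↔ Addb M a := by
  unfold addF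
  rw [Finset.mem_filter]
  refine ⟨fun h => h.2, fun h => ⟨?_, h⟩⟩
  have v := h.val
  have ha := Finset.mem_insert_self a M
  obtain ⟨i, j⟩ := a
  simp only at v
  rw [Finset.mem_insert, Finset.mem_union, Finset.mem_image, Finset.mem_image]
  by_cases hj : j = i + 1
  · by_cases hi : i = 1
    · left; rw [hj, hi]
    · right; left
      refine ⟨(i - 1, j), ?_, by simp; omega⟩
      have := h.2.nw (q := (i - 1, j)) ha (by simp; omega) (by simp; omega) (by simp) le_rfl
      rw [Finset.mem_insert] at this
      rcases this with h | h
      · simp at h; omega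
      · exact h
  · right; right
    refine ⟨(i, j - 1), ?_, by simp; omega⟩
    have := h.2.nw (q := (i, j - 1)) ha (by simp; omega) (by simp; omega) (by simp) (by simp)
    rw [Finset.mem_insert] at this
    rcases this with h | h
    · simp at h; omega
    · exact h

lemma Addb.rem {M : Finset (ℕ × ℕ)} (hM : Shp M) {a : ℕ × ℕ} (h : Addb M a) :
    Rem (insert a M) a := by
  have v := h.val
  refine ⟨Finset.mem_insert_self _ _, fun h' => ?_, fun h' => ?_⟩ <;>
    rw [Finset.mem_insert] at h' <;> rcases h' with h' | h'
  · have := congrArg Prod.fst h'; simp at this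
  · exact h.1 (hM.nw h' v.1 v.2 (by simp) (by simp))
  · have := congrArg Prod.snd h'; simp at this
  · exact h.1 (hM.nw h' v.1 v.2 (by simp) (by simp))

lemma Rem.of_insert {M : Finset (ℕ × ℕ)} {a d : ℕ × ℕ} (h : Rem (insert a M) d) (hne : d ≠ a) :
    Rem M d := by
  obtain ⟨h1, h2, h3⟩ := h
  exact ⟨(Finset.mem_insert.1 h1).resolve_left hne, fun h => h2 (Finset.mem_insert_of_mem h),
    fun h => h3 (Finset.mem_insert_of_mem h)⟩

lemma Addb.aux {M : Finset (ℕ × ℕ)} {a b : ℕ × ℕ} (ha : Addb M a) (hb : Addb M b)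
    (h1 : a.1 ≤ b.1) (h2 : a.2 ≤ b.2) : a = b := by
  have := hb.2.nw (Finset.mem_insert_self _ _) ha.val.1 ha.val.2 h1 h2
  exact (Finset.mem_insert.1 this).resolve_right ha.1

lemma Addb.unique {M : Finset (ℕ × ℕ)} {a b : ℕ × ℕ} (ha : Addb M a) (hb : Addb M b)
    (hc : col a = col b) : a = b := by
  have := (col_eq ha.val.2 hb.val.2).1 hc
  rcases le_total a.1 b.1 with h | h
  · exact ha.aux hb h (by omega)
  · exact (hb.aux ha h (by omega)).symm

lemma Addb.ne_rem {M : Finset (ℕ × ℕ)} (hM : Shp M) {a b : ℕ × ℕ} (ha : Addb M a) (hb : Rem M b) :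
    col a ≠ col b := by
  intro hc
  have va := ha.val
  have vb := hM.val hb.1
  have := (col_eq va.2 vb.2).1 hc
  rcases le_or_gt a.1 b.1 with h | h
  · exact ha.1 (hM.nw hb.1 va.1 va.2 h (by omega))
  · have h' := ha.2.nw (q := (b.1, b.2 + 1)) (Finset.mem_insert_self _ _) vb.1 (by simp; omega)
      h.le (by simp; omega)
    rcases Finset.mem_insert.1 h' with h' | h'
    · have := congrArg Prod.fst h'; simp at this; omega
    · exact hb.2.2 h'

lemma addF_rem {M : Finset (ℕ × ℕ)} (hM : Shp M) {b : ℕ × ℕ} (hb : Rem M b) :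
    (addF M).filter (fun a => Rem (insert a M) b) = (addF (M.erase b)).erase b := by
  have vb := hM.val hb.1
  ext a
  rw [Finset.mem_filter, Finset.mem_erase, mem_addF, mem_addF]
  constructor
  · rintro ⟨h1, h2⟩
    have hne : a ≠ b := fun h => h1.1 (h ▸ hb.1)
    refine ⟨hne, fun h => h1.1 (Finset.mem_of_mem_erase h), ?_⟩
    rw [← Finset.erase_insert_of_ne hne]
    exact h1.2.erase h2
  · rintro ⟨hne, h1, h2⟩
    have haM : a ∉ M := fun h => h1 (Finset.mem_erase.2 ⟨hne, h⟩)
    have hbn : b ∉ insert a (M.erase b) := by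
      rw [Finset.mem_insert]; simp [hne.symm]
    have hu : Shp (insert a M) := by
      have := h2.union hM
      convert this using 1
      ext x
      simp only [Finset.mem_insert, Finset.mem_union, Finset.mem_erase]
      tauto
    refine ⟨⟨haM, hu⟩, Finset.mem_insert_of_mem hb.1, fun h => ?_, fun h => ?_⟩ <;>
      rcases Finset.mem_insert.1 h with h | h
    · exact hbn (h2.nw (Finset.mem_insert_self _ _) vb.1 vb.2 (by rw [← h]; simp)
        (by rw [← h]))
    · exact hb.2.1 h
    · exact hbn (h2.nw (Finset.mem_insert_self _ _) vb.1 vb.2 (by rw [← h])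
        (by rw [← h]; simp))
    · exact hb.2.2 h

lemma exists_rem {L : Finset (ℕ × ℕ)} (hL : L.Nonempty) : ∃ c, Rem L c := by
  obtain ⟨c, hc, hmax⟩ := Finset.exists_max_image L (fun p => p.1 + p.2) hL
  refine ⟨c, hc, fun h => ?_, fun h => ?_⟩
  · have := hmax _ h; simp at this
  · have := hmax _ h; simp at this

theorem chev (n : ℕ) : ∀ L : Finset (ℕ × ℕ), L.card = n → Shp L → ∀ (Y : ℕ → ℝ)
    (M : Finset (ℕ × ℕ)), Shp M →
    ∑ a ∈ addF M, EE L Y (insert a M) = (Zw L Y - Zw M Y) * EE L Y M := by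
  induction n with
  | zero =>
    intro L hn hL Y M hM
    rw [Finset.card_eq_zero] at hn
    subst hn
    rw [Finset.sum_eq_zero]
    · by_cases h : M ⊆ ∅
      · rw [Finset.subset_empty] at h
        subst h; simp
      · rw [EE_zero hL h, mul_zero]
    · intro a _
      apply EE_zero hL
      intro h
      simpa using h (Finset.mem_insert_self a M)
  | succ n ih =>
    intro L hn hL Y M hM
    obtain ⟨c, hc⟩ := exists_rem (L := L) (by rw [← Finset.card_pos]; omega)
    have ih' := ih (L.erase c) (by rw [Finset.card_erase_of_mem hc.1]; omega) (hL.erase hc)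
      (sY (col c) Y)
    have ZL := Zlaw1 hL hc Y
    have hsum : ∑ a ∈ addF M, EE L Y (insert a M) =
        ∑ a ∈ addF M, EE (L.erase c) (sY (col c) Y) (insert a M) + al (col c) Y *
          ∑ a ∈ addF M, ∑ b ∈ remS (insert a M) (col c),
            EE (L.erase c) (sY (col c) Y) ((insert a M).erase b) := by
      rw [Finset.mul_sum, ← Finset.sum_add_distrib]
      exact Finset.sum_congr rfl fun a ha => EE_rec hL (mem_addF.1 ha).2 hc Y
    rw [hsum, EE_rec hL hM hc, ih' M hM, ZL]
    by_cases hA : ∃ a, Addb M a ∧ col a = col c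
    · obtain ⟨a, ha, hac⟩ := hA
      have hr : remS M (col c) = ∅ := remS_empty (by
        rintro ⟨b, hb, hbc⟩
        exact ha.ne_rem hM hb (hac.trans hbc.symm))
      have hs : ∑ a ∈ addF M, ∑ b ∈ remS (insert a M) (col c),
          EE (L.erase c) (sY (col c) Y) ((insert a M).erase b) =
          EE (L.erase c) (sY (col c) Y) M := by
        rw [Finset.sum_eq_single a]
        · rw [← hac, remS_single ha.2 (ha.rem hM), Finset.sum_singleton,
            Finset.erase_insert ha.1]
        · intro a' ha' hne
          rw [mem_addF] at ha'
          rw [remS_empty, Finset.sum_empty]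
          rintro ⟨b, hb, hbc⟩
          by_cases hba : b = a'
          · exact hne (ha'.unique ha (by rw [← hba, hbc, hac]))
          · exact ha.ne_rem hM (hb.of_insert hba) (hac.trans hbc.symm)
        · intro h; exact absurd (mem_addF.2 ha) h
      have Z2 := Zlaw1 ha.2 (ha.rem hM) Y
      have Z3 := Zw_erase (Finset.mem_insert_self a M) Y
      rw [Finset.erase_insert ha.1] at Z2 Z3
      rw [hac] at Z2 Z3
      rw [hs, hr, Finset.sum_empty, Z2, Z3]
      ring
    · by_cases hB : ∃ b, Rem M b ∧ col b = col c
      · obtain ⟨b, hb, hbc⟩ := hB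
        have hr : remS M (col c) = {b} := by rw [← hbc]; exact remS_single hM hb
        have hbA : Addb (M.erase b) b := ⟨by simp, by rw [Finset.insert_erase hb.1]; exact hM⟩
        have hs : ∑ a ∈ addF M, ∑ b ∈ remS (insert a M) (col c),
            EE (L.erase c) (sY (col c) Y) ((insert a M).erase b) =
            ∑ a ∈ addF (M.erase b), EE (L.erase c) (sY (col c) Y) (insert a (M.erase b))
              - EE (L.erase c) (sY (col c) Y) M := by
          rw [← Finset.sum_erase_add _ _ (mem_addF.2 hbA), Finset.insert_erase hb.1,
            add_sub_cancel_right, ← addF_rem hM hb, Finset.sum_filter]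
          refine Finset.sum_congr rfl fun a ha => ?_
          rw [mem_addF] at ha
          have hab : a ≠ b := fun h => ha.1 (h ▸ hb.1)
          split_ifs with h
          · rw [← hbc, remS_single ha.2 h, Finset.sum_singleton,
              Finset.erase_insert_of_ne hab]
          · rw [remS_empty, Finset.sum_empty]
            rintro ⟨d, hd, hdc⟩
            by_cases hda : d = a
            · exact hA ⟨a, ha, by rw [← hda, hdc]⟩
            · have := (hd.of_insert hda).unique hb hM (hdc.trans hbc.symm)
              exact h (this ▸ hd)
        have Z2 := Zlaw1 hM hb Y
        have Z3 := Zlaw2 hM hb Y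
        rw [hbc] at Z2 Z3
        rw [hs, hr, Finset.sum_singleton, ih' _ (hM.erase hb), ZL, Z2, Z3]
        ring
      · have hs : ∑ a ∈ addF M, ∑ b ∈ remS (insert a M) (col c),
            EE (L.erase c) (sY (col c) Y) ((insert a M).erase b) = 0 := by
          apply Finset.sum_eq_zero
          intro a ha
          rw [mem_addF] at ha
          rw [remS_empty, Finset.sum_empty]
          rintro ⟨d, hd, hdc⟩
          by_cases hda : d = a
          · exact hA ⟨a, ha, by rw [← hda, hdc]⟩
          · exact hB ⟨d, hd.of_insert hda, hdc⟩
        rw [hs, remS_empty hB, Finset.sum_empty, Zlaw3 hM hA hB]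
        ring


noncomputable def minC (C : Finset (ℕ × ℕ)) : Finset (ℕ × ℕ) :=
  C.filter (fun b => ∀ p ∈ C, ¬ (p.1 + 1 = b.1 ∧ p.2 = b.2) ∧ ¬ (p.1 = b.1 ∧ p.2 + 1 = b.2))

noncomputable def Phi (b : ℕ × ℕ) (T : ℕ × ℕ → ℕ) : ℕ × ℕ → ℕ :=
  fun p => if p = b then 1 else if T p = 0 then 0 else T p + 1

lemma syt_ge {C : Finset (ℕ × ℕ)} {T : ℕ × ℕ → ℕ} (h : IsSYT C T) {p : ℕ × ℕ} (hp : p ∈ C) :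
    1 ≤ T p ∧ T p ≤ C.card := by
  have := h.1.1 (Finset.mem_coe.2 hp)
  rwa [Finset.mem_coe, Finset.mem_Icc] at this

lemma syt_down {C : Finset (ℕ × ℕ)} {T : ℕ × ℕ → ℕ} (h : IsSYT C T) {b : ℕ × ℕ} (hb : b ∈ C)
    (hT : T b = 1) : b ∈ minC C ∧ IsSYT (C.erase b) (fun p => T p - 1) ∧
      Phi b (fun p => T p - 1) = T := by
  have hge := @syt_ge C T h
  obtain ⟨⟨h1, h2, h3⟩, h4, h5, h6⟩ := h
  have hne : ∀ p, p ∈ C → p ≠ b → 2 ≤ T p := by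
    intro p hp hpb
    have := hge hp
    have : T p ≠ 1 := fun h' => hpb (h2 (Finset.mem_coe.2 hp) (Finset.mem_coe.2 hb) (h'.trans hT.symm))
    omega
  refine ⟨?_, ⟨⟨?_, ?_, ?_⟩, ?_, ?_, ?_⟩, ?_⟩
  · rw [minC, Finset.mem_filter]
    refine ⟨hb, ?_⟩
    rintro ⟨i, j⟩ hp
    obtain ⟨a, d⟩ := b
    have := hge hp
    constructor
    · rintro ⟨rfl, rfl⟩
      have := h6 _ _ hp hb
      simp only at hT this; omega
    · rintro ⟨rfl, rfl⟩
      have := h5 _ _ hp hb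
      simp only at hT this; omega
  · intro p hp
    rw [Finset.mem_coe, Finset.mem_erase] at hp
    have := hne p hp.2 hp.1
    have := hge hp.2
    rw [Finset.mem_coe, Finset.mem_Icc, Finset.card_erase_of_mem hb]
    simp only
    omega
  · intro p hp q hq hpq
    rw [Finset.mem_coe, Finset.mem_erase] at hp hq
    have := hne p hp.2 hp.1
    have := hne q hq.2 hq.1
    simp only at hpq
    exact h2 (Finset.mem_coe.2 hp.2) (Finset.mem_coe.2 hq.2) (by omega)
  · intro k hk
    rw [Finset.mem_coe, Finset.mem_Icc, Finset.card_erase_of_mem hb] at hk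
    obtain ⟨p, hp, hpk⟩ := h3 (show k + 1 ∈ _ by rw [Finset.mem_coe, Finset.mem_Icc]; omega)
    refine ⟨p, ?_, by simp only; omega⟩
    rw [Finset.mem_coe, Finset.mem_erase]
    exact ⟨fun h => by rw [h] at hpk; omega, hp⟩
  · intro p hp
    rw [Finset.mem_erase] at hp
    by_cases hpb : p = b
    · rw [hpb]; simp only; omega
    · have := h4 p (fun h => hp ⟨hpb, h⟩)
      simp only; omega
  · intro i j hp hq
    rw [Finset.mem_erase] at hp hq
    have := h5 i j hp.2 hq.2
    have := hne _ hp.2 hp.1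
    simp only; omega
  · intro i j hp hq
    rw [Finset.mem_erase] at hp hq
    have := h6 i j hp.2 hq.2
    have := hne _ hp.2 hp.1
    simp only; omega
  · funext p
    unfold Phi
    by_cases hpb : p = b
    · rw [if_pos hpb, hpb, hT]
    · rw [if_neg hpb]
      by_cases hp : p ∈ C
      · have := hne p hp hpb
        rw [if_neg (by simp only; omega)]; simp only; omega
      · have := h4 p hp
        rw [if_pos (by simp only; omega)]; omega

lemma Phi_self (b : ℕ × ℕ) (T : ℕ × ℕ → ℕ) : Phi b T b = 1 := by simp [Phi]

lemma Phi_ne {C : Finset (ℕ × ℕ)} {b : ℕ × ℕ} {T : ℕ × ℕ → ℕ} (h : IsSYT (C.erase b) T)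
    {p : ℕ × ℕ} (hp : p ∈ C) (hpb : p ≠ b) : Phi b T p = T p + 1 := by
  have := syt_ge h (Finset.mem_erase.2 ⟨hpb, hp⟩)
  unfold Phi
  rw [if_neg hpb, if_neg (by omega)]

lemma Phi_sub {C : Finset (ℕ × ℕ)} {b : ℕ × ℕ} {T : ℕ × ℕ → ℕ} (h : IsSYT (C.erase b) T) :
    (fun p => Phi b T p - 1) = T := by
  funext p
  unfold Phi
  by_cases hpb : p = b
  · rw [if_pos hpb, hpb, h.2.1 b (by simp)]
  · rw [if_neg hpb]; split_ifs <;> omega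

lemma syt_up {C : Finset (ℕ × ℕ)} {b : ℕ × ℕ} (hb : b ∈ minC C) {T : ℕ × ℕ → ℕ}
    (h : IsSYT (C.erase b) T) : IsSYT C (Phi b T) := by
  have hge := @syt_ge _ T h
  have hP := @Phi_ne C b T h
  have hself := Phi_self b T
  rw [minC, Finset.mem_filter] at hb
  obtain ⟨hb, hmin⟩ := hb
  have hcard := Finset.card_erase_add_one hb
  obtain ⟨⟨h1, h2, h3⟩, h4, h5, h6⟩ := h
  refine ⟨⟨?_, ?_, ?_⟩, ?_, ?_, ?_⟩
  · intro p hp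
    rw [Finset.mem_coe] at hp
    rw [Finset.mem_coe, Finset.mem_Icc]
    by_cases hpb : p = b
    · rw [hpb, hself]; omega
    · have := hge (Finset.mem_erase.2 ⟨hpb, hp⟩)
      rw [hP hp hpb]; omega
  · intro p hp q hq hpq
    rw [Finset.mem_coe] at hp hq
    by_cases hpb : p = b <;> by_cases hqb : q = b
    · rw [hpb, hqb]
    · have := hge (Finset.mem_erase.2 ⟨hqb, hq⟩)
      rw [hpb, hself, hP hq hqb] at hpq; omega
    · have := hge (Finset.mem_erase.2 ⟨hpb, hp⟩)
      rw [hqb, hself, hP hp hpb] at hpq; omega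
    · rw [hP hp hpb, hP hq hqb] at hpq
      exact h2 (Finset.mem_coe.2 (Finset.mem_erase.2 ⟨hpb, hp⟩))
        (Finset.mem_coe.2 (Finset.mem_erase.2 ⟨hqb, hq⟩)) (by omega)
  · intro k hk
    rw [Finset.mem_coe, Finset.mem_Icc] at hk
    by_cases hk1 : k = 1
    · exact ⟨b, hb, by rw [hself, hk1]⟩
    · obtain ⟨p, hp, hpk⟩ := h3 (show k - 1 ∈ _ by rw [Finset.mem_coe, Finset.mem_Icc]; omega)
      rw [Finset.mem_coe, Finset.mem_erase] at hp
      exact ⟨p, hp.2, by rw [hP hp.2 hp.1]; omega⟩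
  · intro p hp
    have hpb : p ≠ b := fun h => hp (h ▸ hb)
    unfold Phi
    rw [if_neg hpb, if_pos (h4 p (fun h => hp (Finset.mem_of_mem_erase h)))]
  · intro i j hp hq
    have hqb : (i, j + 1) ≠ b := by
      rintro rfl
      exact (hmin _ hp).2 ⟨rfl, rfl⟩
    have := hge (Finset.mem_erase.2 ⟨hqb, hq⟩)
    by_cases hpb : (i, j) = b
    · rw [hP hq hqb, hpb, hself]; omega
    · rw [hP hq hqb, hP hp hpb]
      have := h5 i j (Finset.mem_erase.2 ⟨hpb, hp⟩) (Finset.mem_erase.2 ⟨hqb, hq⟩)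
      omega
  · intro i j hp hq
    have hqb : (i + 1, j) ≠ b := by
      rintro rfl
      exact (hmin _ hp).1 ⟨rfl, rfl⟩
    have := hge (Finset.mem_erase.2 ⟨hqb, hq⟩)
    by_cases hpb : (i, j) = b
    · rw [hP hq hqb, hpb, hself]; omega
    · rw [hP hq hqb, hP hp hpb]
      have := h6 i j (Finset.mem_erase.2 ⟨hpb, hp⟩) (Finset.mem_erase.2 ⟨hqb, hq⟩)
      omega

lemma Tz_Phi {C : Finset (ℕ × ℕ)} {b : ℕ × ℕ} (hb : b ∈ C) {T : ℕ × ℕ → ℕ}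
    (h : IsSYT (C.erase b) T) (z : ℕ → ℝ) :
    Tz C z (Phi b T) = (∑ p ∈ C, z (p.2 - p.1))⁻¹ * Tz (C.erase b) z T := by
  have hge := @syt_ge _ T h
  have hP := @Phi_ne C b T h
  have hself := Phi_self b T
  have hcard := Finset.card_erase_add_one hb
  unfold Tz
  rw [← hcard, ← Finset.mul_prod_Ioc_eq_prod_Icc (by omega)]
  congr 1
  · congr 2
    rw [Finset.filter_true_of_mem]
    intro p hp
    by_cases hpb : p = b
    · rw [hpb, hself]
    · rw [hP hp hpb]; omega
  · symm
    refine Finset.prod_bij' (fun k _ => k + 1) (fun k _ => k - 1) ?_ ?_ ?_ ?_ ?_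
    · intro k hk; rw [Finset.mem_Icc] at hk; rw [Finset.mem_Ioc]; omega
    · intro k hk; rw [Finset.mem_Ioc] at hk; rw [Finset.mem_Icc]; omega
    · intro k hk; simp
    · intro k hk; rw [Finset.mem_Ioc] at hk; omega
    · intro k hk
      rw [Finset.mem_Icc] at hk
      congr 2
      ext p
      rw [Finset.mem_filter, Finset.mem_filter, Finset.mem_erase]
      by_cases hpb : p = b
      · simp only [hpb, hself, ne_eq, not_true, false_and, false_iff, not_and]
        intro _; omega
      · constructor
        · rintro ⟨⟨_, h1⟩, h2⟩
          exact ⟨h1, by rw [hP h1 hpb]; omega⟩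
        · rintro ⟨h1, h2⟩
          rw [hP h1 hpb] at h2
          exact ⟨⟨hpb, h1⟩, by omega⟩

lemma syt_union {C : Finset (ℕ × ℕ)} (hC : C.Nonempty) :
    {T | IsSYT C T} = ⋃ b ∈ (minC C : Set (ℕ × ℕ)), Phi b '' {T | IsSYT (C.erase b) T} := by
  ext T
  simp only [Set.mem_iUnion, Set.mem_image, Set.mem_ofPred_eq, Finset.mem_coe, exists_prop]
  constructor
  · intro h
    obtain ⟨b, hb, hT⟩ := h.1.2.2 (show 1 ∈ _ by
      rw [Finset.mem_coe, Finset.mem_Icc]; have := hC.card_pos; omega)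
    obtain ⟨h1, h2, h3⟩ := syt_down h hb hT
    exact ⟨b, h1, _, h2, h3⟩
  · rintro ⟨b, hb, T', hT', rfl⟩
    exact syt_up hb hT'

lemma syt_empty : {T | IsSYT ∅ T} = {fun _ => 0} := by
  ext T
  rw [Set.mem_ofPred_eq, Set.mem_singleton_iff]
  constructor
  · intro h; funext p; exact h.2.1 p (by simp)
  · rintro rfl
    refine ⟨?_, by simp, by simp, by simp⟩
    simp

lemma minC_sub {C : Finset (ℕ × ℕ)} {b : ℕ × ℕ} (hb : b ∈ minC C) : b ∈ C :=
  (Finset.mem_filter.1 hb).1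

lemma syt_finite (n : ℕ) : ∀ C : Finset (ℕ × ℕ), C.card = n → {T | IsSYT C T}.Finite := by
  induction n with
  | zero =>
    intro C hC
    rw [Finset.card_eq_zero] at hC
    rw [hC, syt_empty]
    exact Set.finite_singleton _
  | succ n ih =>
    intro C hC
    rw [syt_union (by rw [← Finset.card_pos]; omega)]
    refine (Finset.finite_toSet _).biUnion fun b hb => Set.Finite.image _ (ih _ ?_)
    rw [Finset.card_erase_of_mem (minC_sub hb)]; omega

noncomputable def WS (C : Finset (ℕ × ℕ)) (z : ℕ → ℝ) : ℝ := ∑ᶠ T ∈ {T | IsSYT C T}, Tz C z T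

lemma WS_empty (z : ℕ → ℝ) : WS ∅ z = 1 := by
  unfold WS
  rw [syt_empty, finsum_mem_singleton]
  simp [Tz]

lemma WS_rec {C : Finset (ℕ × ℕ)} (hC : C.Nonempty) (z : ℕ → ℝ) :
    WS C z = (∑ p ∈ C, z (p.2 - p.1))⁻¹ * ∑ b ∈ minC C, WS (C.erase b) z := by
  have e : WS C z = ∑ᶠ T ∈ ⋃ b ∈ (minC C : Set (ℕ × ℕ)), Phi b '' {T | IsSYT (C.erase b) T},
      Tz C z T := by
    unfold WS; rw [← syt_union hC]
  rw [e, finsum_mem_biUnion, finsum_mem_coe_finset, Finset.mul_sum]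
  · refine Finset.sum_congr rfl fun b hb => ?_
    unfold WS
    rw [finsum_mem_image, mul_finsum_mem]
    · exact finsum_mem_congr rfl fun T hT => Tz_Phi (minC_sub hb) hT z
    · intro T hT T' hT' heq
      rw [← Phi_sub hT, ← Phi_sub hT', heq]
  · intro b hb b' hb' hne
    rw [Function.onFun, Set.disjoint_left]
    rintro T ⟨T1, hT1, rfl⟩ ⟨T2, hT2, h2⟩
    have h1 := Phi_self b T1
    rw [← h2, Phi_ne hT2 (minC_sub hb) hne] at h1
    have := syt_ge hT2 (Finset.mem_erase.2 ⟨hne, minC_sub hb⟩)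
    omega
  · exact Finset.finite_toSet _
  · intro b _
    exact Set.Finite.image _ (syt_finite _ _ rfl)


noncomputable def YZ (z : ℕ → ℝ) (k : ℕ) : ℝ := ∑ t ∈ Finset.range k, z (t + 1)

lemma YZ_zero (z : ℕ → ℝ) : YZ z 0 = 0 := by simp [YZ]

lemma YZ_sub (z : ℕ → ℝ) {a b : ℕ} (h : a ≤ b) :
    ∑ t ∈ Finset.Ico a b, z (t + 1) = YZ z b - YZ z a :=
  Finset.sum_Ico_eq_sub _ h

lemma al_YZ (z : ℕ → ℝ) {v : ℕ × ℕ} (hv : v.1 < v.2) : al (col v) (YZ z) = z (v.2 - v.1) := by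
  have key : ∀ k, YZ z (k + 1) - YZ z k = z (k + 1) := by
    intro k; unfold YZ; rw [Finset.sum_range_succ]; ring
  have k1 := key 0
  rw [YZ_zero] at k1
  unfold al col
  split_ifs with h1 h2 h3
  · rw [YZ_zero, h1]; simpa using k1
  · have : v.1 % 2 = 1 := by omega
    rw [this, h1]; simpa [YZ_zero] using k1
  · omega
  · have := key (v.2 - v.1 - 1)
    rwa [show v.2 - v.1 - 1 + 1 = v.2 - v.1 by omega] at this

lemma row_hook {S : Finset (ℕ × ℕ)} (hS : Shp S) (z : ℕ → ℝ) {i a : ℕ} (hi : 1 ≤ i)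
    (ha : a ≤ len S i) :
    ∑ p ∈ S.filter (fun p => p.1 = i ∧ i + a + 1 ≤ p.2), z (p.2 - p.1) =
      YZ z (len S i) - YZ z a := by
  rw [← YZ_sub z ha]
  refine Finset.sum_bij' (fun p _ => p.2 - p.1 - 1) (fun t _ => (i, i + t + 1)) ?_ ?_ ?_ ?_ ?_
  · rintro ⟨x, y⟩ hp
    rw [Finset.mem_filter, mem_len hS] at hp
    obtain ⟨h1, rfl, h3⟩ := hp
    simp only at *
    rw [Finset.mem_Ico]; omega
  · intro t ht
    rw [Finset.mem_Ico] at ht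
    rw [Finset.mem_filter, mem_len hS]
    exact ⟨by omega, rfl, by show _ ≤ i + t + 1; omega⟩
  · rintro ⟨x, y⟩ hp
    rw [Finset.mem_filter, mem_len hS] at hp
    simp only [Prod.mk.injEq] at *; omega
  · intro t ht
    simp only; omega
  · rintro ⟨x, y⟩ hp
    rw [Finset.mem_filter, mem_len hS] at hp
    simp only at *
    congr 1; omega

lemma tl_lt {S : Finset (ℕ × ℕ)} (hS : Shp S) {j : ℕ} (hj : 1 ≤ j) : tl S j < j := by
  by_contra h
  have := (mem_tl hS (tl S j) j).2 ⟨by omega, le_rfl⟩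
  have := hS.val this
  simp only at this; omega

lemma col_hook {S : Finset (ℕ × ℕ)} (hS : Shp S) (z : ℕ → ℝ) {i j : ℕ}
    (hij : (i, j) ∈ S) :
    ∑ p ∈ S.filter (fun p => p.2 = j ∧ i < p.1), z (p.2 - p.1) =
      YZ z (j - i - 1) - YZ z (j - 1 - tl S j) := by
  have v := hS.val hij
  simp only at v
  have hi := (mem_tl hS i j).1 hij
  have ht := tl_lt hS (j := j) (by omega)
  rw [← YZ_sub z (by omega)]
  refine Finset.sum_bij' (fun p _ => p.2 - p.1 - 1) (fun t _ => (j - 1 - t, j)) ?_ ?_ ?_ ?_ ?_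
  · rintro ⟨x, y⟩ hp
    rw [Finset.mem_filter, mem_tl hS] at hp
    obtain ⟨h1, rfl, h3⟩ := hp
    simp only at *
    rw [Finset.mem_Ico]; omega
  · intro t ht
    rw [Finset.mem_Ico] at ht
    rw [Finset.mem_filter, mem_tl hS]
    exact ⟨by omega, rfl, by show _ < j - 1 - t; omega⟩
  · rintro ⟨x, y⟩ hp
    rw [Finset.mem_filter] at hp
    have v := hS.val hp.1
    simp only [Prod.mk.injEq] at *; omega
  · intro t ht
    rw [Finset.mem_Ico] at ht
    simp only; omega
  · rintro ⟨x, y⟩ hp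
    have v := hS.val (Finset.mem_filter.1 hp).1
    simp only at *
    congr 1; omega

lemma hook_eq {l : ℕ → ℕ} (hS : Shp (cellsD l)) (z : ℕ → ℝ) {u : ℕ × ℕ} (hu : u ∈ cellsD l) :
    hDz l z u = hk (cellsD l) (YZ z) u := by
  obtain ⟨i, j⟩ := u
  have v := hS.val hu
  simp only at v
  have hl := (mem_len hS i j).1 hu
  have h1 := row_hook hS z (i := i) (a := j - i - 1) v.1 (by omega)
  rw [show i + (j - i - 1) + 1 = j by omega] at h1
  have h2 := col_hook hS z hu
  have h3 := row_hook hS z (i := j) (a := 0) (by omega) (by omega)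
  have h4 : (cellsD l).filter (fun p => p.1 = j ∧ j + 0 + 1 ≤ p.2) =
      (cellsD l).filter (fun p => p.1 = j) := by
    apply Finset.filter_congr
    intro p hp
    have := hS.val hp
    constructor
    · exact fun h => h.1
    · intro h; omega
  rw [h4] at h3
  unfold hDz hk Ww
  simp only
  rw [h1, h2, h3, YZ_zero]
  have ht := tl_lt hS (j := j) (by omega)
  split_ifs with c1 c2
  · have m1 : (j, j + 1) ∈ cellsD l := (mem_len hS j (j + 1)).2 (by omega)
    have m2 : (j - 1, j) ∈ cellsD l :=
      hS.nw m1 (by simp; omega) (by simp; omega) (by simp) (by simp)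
    have := (mem_tl hS _ _).1 m2
    rw [show j - 1 - tl (cellsD l) j = 0 by omega, YZ_zero]; ring
  · rw [show j - 1 - tl (cellsD l) j = 0 by omega, YZ_zero,
      show len (cellsD l) j = 0 by omega, YZ_zero]; ring
  · rw [show len (cellsD l) j = 0 by omega, YZ_zero]; ring

lemma hook_pos {l : ℕ → ℕ} {z : ℕ → ℝ} (hz : ∀ i, 0 < z i) {u : ℕ × ℕ} (hu : u ∈ cellsD l) :
    0 < hDz l z u := by
  unfold hDz
  have h1 : 0 < ∑ p ∈ (cellsD l).filter (fun p => p.1 = u.1 ∧ u.2 ≤ p.2), z (p.2 - p.1) :=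
    Finset.sum_pos (fun p _ => hz _) ⟨u, by rw [Finset.mem_filter]; exact ⟨hu, rfl, le_rfl⟩⟩
  have h2 : 0 ≤ ∑ p ∈ (cellsD l).filter (fun p => p.2 = u.2 ∧ u.1 < p.1), z (p.2 - p.1) :=
    Finset.sum_nonneg fun p _ => (hz _).le
  have h3 : 0 ≤ ∑ p ∈ (cellsD l).filter (fun p => p.1 = u.2), z (p.2 - p.1) :=
    Finset.sum_nonneg fun p _ => (hz _).le
  linarith

lemma strict_anti {l : ℕ → ℕ} (hl : IsStrictPartition l) (k : ℕ) :
    ∀ i, 1 ≤ i → l (i + k) ≠ 0 → l (i + k) + k ≤ l i := by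
  induction k with
  | zero => intro i _ _; simp
  | succ k ih =>
    intro i hi h
    have h1 := hl.2 (i + k) (by omega)
    rw [show i + (k + 1) = i + k + 1 from rfl] at h ⊢
    have h2 : l (i + k) ≠ 0 := fun h' => h (h1.1 h')
    have := h1.2 h2
    have := ih i hi h2
    omega

lemma mem_cellsD {l : ℕ → ℕ} (hl : IsStrictPartition l) (i j : ℕ) :
    (i, j) ∈ cellsD l ↔ 1 ≤ i ∧ i < j ∧ j ≤ l i + i := by
  unfold cellsD
  rw [Finset.mem_filter, Finset.mem_product, Finset.mem_Icc, Finset.mem_Icc]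
  simp only
  constructor
  · rintro ⟨⟨⟨h1, h2⟩, h3, h4⟩, h5, h6⟩; exact ⟨h1, h5, h6⟩
  · rintro ⟨h1, h2, h3⟩
    have := strict_anti hl (i - 1) 1 le_rfl
    rw [show 1 + (i - 1) = i by omega] at this
    have := this (by omega)
    omega

lemma shp_cellsD {l : ℕ → ℕ} (hl : IsStrictPartition l) : Shp (cellsD l) := by
  refine ⟨fun i j h => ?_, fun i j h hi => ?_, fun i j h hi => ?_⟩ <;>
    rw [mem_cellsD hl] at *
  · omega
  · have := strict_anti hl 1 i hi (by omega)
    omega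
  · omega

lemma minC_skew {L M : Finset (ℕ × ℕ)} (hL : Shp L) (hM : Shp M) (_hML : M ⊆ L) :
    minC (L \ M) = (addF M).filter (fun b => b ∈ L) := by
  ext ⟨i, j⟩
  rw [minC, Finset.mem_filter, Finset.mem_filter, mem_addF, Finset.mem_sdiff]
  constructor
  · rintro ⟨⟨h1, h2⟩, h3⟩
    have v := hL.val h1
    simp only at v
    refine ⟨⟨h2, hM.insert v.1 v.2 (fun h => ?_) (fun h => ?_)⟩, h1⟩
    · by_contra hn
      have hm : (i - 1, j) ∈ L :=
        hL.nw h1 (by simp; omega) (by simp; omega) (by simp) (by simp)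
      exact (h3 _ (Finset.mem_sdiff.2 ⟨hm, hn⟩)).1 ⟨by simp; omega, rfl⟩
    · by_contra hn
      have hm : (i, j - 1) ∈ L :=
        hL.nw h1 (by simp; omega) (by simp; omega) (by simp) (by simp)
      exact (h3 _ (Finset.mem_sdiff.2 ⟨hm, hn⟩)).2 ⟨rfl, by simp; omega⟩
  · rintro ⟨h1, h2⟩
    refine ⟨⟨h2, h1.1⟩, ?_⟩
    rintro ⟨a, b⟩ hp
    rw [Finset.mem_sdiff] at hp
    have v := hL.val hp.1
    constructor
    · rintro ⟨e1, e2⟩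
      simp only at e1 e2 v
      have := h1.2.nw (q := (a, b)) (Finset.mem_insert_self _ _) v.1 v.2 (by simp; omega)
        (by simp; omega)
      rcases Finset.mem_insert.1 this with h | h
      · have := congrArg Prod.fst h; simp at this; omega
      · exact hp.2 h
    · rintro ⟨e1, e2⟩
      simp only at e1 e2 v
      have := h1.2.nw (q := (a, b)) (Finset.mem_insert_self _ _) v.1 v.2 (by simp; omega)
        (by simp; omega)
      rcases Finset.mem_insert.1 this with h | h
      · have := congrArg Prod.snd h; simp at this; omega
      · exact hp.2 h

lemma EE_self (L : Finset (ℕ × ℕ)) (Y : ℕ → ℝ) : EE L Y L = ∏ u ∈ L, hk L Y u := by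
  have : Exc L L = {L} := by
    ext D
    rw [mem_Exc, Finset.mem_singleton]
    constructor
    · rintro ⟨hs, h⟩
      clear hs
      induction h with
      | refl => rfl
      | tail _ h2 ih =>
        subst ih
        obtain ⟨v, v', hs, hv, hr, rfl⟩ := h2
        exact absurd (hr v' hs.rect).1 (hr v' hs.rect).2
    · rintro rfl; exact ⟨subset_rfl, .refl⟩
  unfold EE
  rw [this, Finset.sum_singleton]

lemma main_claim {L : Finset (ℕ × ℕ)} (hL : Shp L) {z : ℕ → ℝ} (hz : ∀ i, 0 < z i) (n : ℕ) :
    ∀ M, Shp M → M ⊆ L → (L \ M).card = n →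
      WS (L \ M) z * ∏ u ∈ L, hk L (YZ z) u = EE L (YZ z) M := by
  induction n with
  | zero =>
    intro M hM hML hn
    rw [Finset.card_eq_zero] at hn
    have : M = L := hML.antisymm (Finset.sdiff_eq_empty_iff_subset.1 hn)
    rw [hn, this, WS_empty, EE_self, one_mul]
  | succ n ih =>
    intro M hM hML hn
    have hne : (L \ M).Nonempty := by rw [← Finset.card_pos]; omega
    have hZ : Zw L (YZ z) - Zw M (YZ z) = ∑ p ∈ L \ M, z (p.2 - p.1) := by
      unfold Zw
      rw [← Finset.sum_sdiff hML, add_sub_cancel_right]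
      refine Finset.sum_congr rfl fun p hp => al_YZ z (hL.val (Finset.mem_sdiff.1 hp).1).2
    have hpos : 0 < ∑ p ∈ L \ M, z (p.2 - p.1) := Finset.sum_pos (fun p _ => hz _) hne
    have hc := chev _ L rfl hL (YZ z) M hM
    rw [hZ] at hc
    rw [WS_rec hne, minC_skew hL hM hML, mul_assoc, Finset.sum_mul, inv_mul_eq_iff_eq_mul₀ hpos.ne',
      ← hc, Finset.sum_filter]
    refine Finset.sum_congr rfl fun b hb => ?_
    rw [mem_addF] at hb
    split_ifs with h
    · have e : (L \ M).erase b = L \ insert b M := by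
        ext x; simp only [Finset.mem_erase, Finset.mem_sdiff, Finset.mem_insert]; tauto
      rw [e]
      refine ih _ hb.2 (Finset.insert_subset h hML) ?_
      rw [← e, Finset.card_erase_of_mem (Finset.mem_sdiff.2 ⟨h, hb.1⟩)]; omega
    · rw [EE_zero hL]
      intro h'
      exact h (h' (Finset.mem_insert_self _ _))

/-- Weighted Naruse formula, type D. -/
theorem statement10 (l m : ℕ → ℕ) (hl : IsStrictPartition l) (hm : IsStrictPartition m)
    (hsub : cellsD m ⊆ cellsD l) (z : ℕ → ℝ) (hz : ∀ i, 0 < z i) :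
    (∑ᶠ T ∈ {T : ℕ × ℕ → ℕ | IsSYT (skewD l m) T}, Tz (skewD l m) z T) =
      ∑ D ∈ ED l m, ∏ p ∈ cellsD l \ D, (hDz l z p)⁻¹ := by
  have hL := shp_cellsD hl
  have hM := shp_cellsD hm
  have hc := main_claim hL hz _ _ hM hsub rfl
  have hP : ∏ u ∈ cellsD l, hk (cellsD l) (YZ z) u ≠ 0 := by
    refine Finset.prod_ne_zero_iff.2 fun u hu => ?_
    rw [← hook_eq hL z hu]
    exact (hook_pos hz hu).ne'
  have hED : ED l m = Exc (cellsD l) (cellsD m) := by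
    unfold ED Exc
    rw [excitedMoveD_eq]
  change WS (cellsD l \ cellsD m) z = _
  rw [eq_div_of_mul_eq hP hc, hED, EE, Finset.sum_div]
  refine Finset.sum_congr rfl fun D hD => ?_
  have hDL := (mem_Exc.1 hD).1
  rw [Finset.prod_inv_distrib, div_eq_iff hP, ← Finset.prod_sdiff hDL,
    Finset.prod_congr rfl (fun u hu => hook_eq hL z (Finset.mem_sdiff.1 hu).1), ← mul_assoc,
    inv_mul_cancel₀, one_mul]
  refine Finset.prod_ne_zero_iff.2 fun u hu => ?_
  have hu := (Finset.mem_sdiff.1 hu).1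
  rw [← hook_eq hL z hu]
  exact (hook_pos hz hu).ne'
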